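/- Let n ≥ 4 and let g₁, g₂ be holomorphic on an open neighborhood Ω of 0 in ℂⁿ with g_i(0) = 0, G = (g₁,g₂) : Ω → ℂ². Assume G^{-1}(0) is an isolated complete intersection singularity of dimension d = n − 2 > 1: O_n/(g₁,g₂) has Krull dimension n − 2 and, on some neighborhood of 0, DG(z) is surjective for every z ∈ G^{-1}(0) ∖ {0}. Let h be holomorphic near 0 in ℂ² with h(0) = 0 and an isolated singularity at the origin (dh(z) ≠ 0 for z ≠ 0 near 0), and set f = h ∘ G. Let K be the ideal of O_n generated by the germs of (∂h/∂w₁) ∘ G and (∂h/∂w₂) ∘ G (by the chain rule J(f) ⊆ K). Then dim_ℂ K/J(f) < ∞ if and only if there is a neighborhood W of 0 in ℂⁿ such that f^{-1}(0) ∩ S(G) ∩ W ⊆ {0}, where S(G) = {z ∈ Ω : DG(z) is not surjective} is the critical set of G. (Corollary 3.8 of the paper.) -/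

import Mathlib

open Filter Topology

set_option maxHeartbeats 1000000
set_option synthInstance.maxHeartbeats 400000

noncomputable section

/-- `ℂⁿ`. -/
abbrev Cn (n : ℕ) : Type := Fin n → ℂ

/-- `Filter.Germ l ℂ` is a `ℂ`-algebra via constant germs. -/
instance germAlgebra {α : Type*} (l : Filter α) : Algebra ℂ (Filter.Germ l ℂ) :=
  ((Filter.Germ.coeRingHom l).comp (Pi.constRingHom α ℂ)).toAlgebra

/-- The local ring `O_n` of germs at `0` of holomorphic functions `ℂⁿ → ℂ`,
realized as the subalgebra of `Filter.Germ (𝓝 0) ℂ` consisting of germs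
having a representative analytic on a neighborhood of `0`. -/
def On (n : ℕ) : Subalgebra ℂ (Filter.Germ (𝓝 (0 : Cn n)) ℂ) where
  carrier := {φ | ∃ f : Cn n → ℂ, AnalyticAt ℂ f 0 ∧ φ = ↑f}
  mul_mem' := by
    rintro a b ⟨f, hf, rfl⟩ ⟨g, hg, rfl⟩
    exact ⟨f * g, hf.mul hg, rfl⟩
  one_mem' := ⟨1, analyticAt_const, rfl⟩
  add_mem' := by
    rintro a b ⟨f, hf, rfl⟩ ⟨g, hg, rfl⟩
    exact ⟨f + g, hf.add hg, rfl⟩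
  zero_mem' := ⟨0, analyticAt_const, rfl⟩
  algebraMap_mem' := fun c => ⟨fun _ => c, analyticAt_const, rfl⟩

/-- The ideal of `O_n` generated by the germs at `0` of a set of functions. -/
def idealOfFuns {n : ℕ} (s : Set (Cn n → ℂ)) : Ideal (On n) :=
  Ideal.span {x : On n | ∃ f ∈ s, (x : Filter.Germ (𝓝 (0 : Cn n)) ℂ) = ↑f}

/-- The `i`-th partial derivative `∂f/∂zᵢ` of `f : ℂⁿ → ℂ`. -/
def pder {n : ℕ} (f : Cn n → ℂ) (i : Fin n) : Cn n → ℂ :=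
  fun z => fderiv ℂ f z (Pi.single i 1)

/-- The jacobian ideal `J(f)` of `O_n`, generated by the germs at `0` of the
partial derivatives of `f`. -/
def jacobianIdeal {n : ℕ} (f : Cn n → ℂ) : Ideal (On n) :=
  idealOfFuns (Set.range (pder f))

/-- For ideals `J ⊆ I` of `O_n`, the quotient `I/J`, realized as the
`ℂ`-subspace of `O_n ⧸ J` given by the image of `I`. -/
def quotIJ {n : ℕ} (I J : Ideal (On n)) : Submodule ℂ ((On n) ⧸ J) :=
  (I.map (Ideal.Quotient.mk J)).restrictScalars ℂ

/-- `f` has a singularity of type `A(d)` at `x ∈ ℂⁿ` (with `r = n - d`):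
there is a biholomorphism `φ` from a neighborhood of `0` in `ℂ^d × ℂ^r` onto a
neighborhood of `x` with `φ 0 = x` and `f (φ (z, w)) - f x = w₁² + ⋯ + w_r²`. -/
def HasAdSingularityAt (n d r : ℕ) (f : Cn n → ℂ) (x : Cn n) : Prop :=
  ∃ (V : Set ((Fin d → ℂ) × (Fin r → ℂ))) (W : Set (Cn n))
    (φ : (Fin d → ℂ) × (Fin r → ℂ) → Cn n) (ψ : Cn n → (Fin d → ℂ) × (Fin r → ℂ)),
    IsOpen V ∧ IsOpen W ∧ (0 : (Fin d → ℂ) × (Fin r → ℂ)) ∈ V ∧ x ∈ W ∧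
    φ 0 = x ∧ AnalyticOnNhd ℂ φ V ∧ AnalyticOnNhd ℂ ψ W ∧
    Set.MapsTo φ V W ∧ Set.MapsTo ψ W V ∧
    (∀ q ∈ V, ψ (φ q) = q) ∧ (∀ y ∈ W, φ (ψ y) = y) ∧
    ∀ q ∈ V, f (φ q) - f x = ∑ i, (q.2 i) ^ 2

/-- Absolutely summable families of complex numbers. -/
abbrev EllOne (ι : Type) : Type := lp (fun _ : ι => ℂ) 1

namespace EllOne

variable {ι : Type}

theorem summable_norm (a : EllOne ι) : Summable fun i => ‖a i‖ := by
  simpa using (lp.memℓp a).summable (by simp)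

theorem norm_eq_tsum (a : EllOne ι) : ‖a‖ = ∑' i, ‖a i‖ := by
  rw [lp.norm_eq_tsum_rpow (by simp)]
  simp

open Classical in
/-- The standard unit vector. -/
def unitVec (i : ι) : EllOne ι := lp.single 1 i (1 : ℂ)

open Classical in
theorem unitVec_apply (i j : ι) : unitVec i j = if j = i then (1 : ℂ) else 0 := by
  simp [unitVec, lp.single_apply, Pi.single_apply]

open Classical in
theorem norm_unitVec (i : ι) : ‖unitVec i‖ = 1 := by
  simp [unitVec, lp.norm_single]

open Classical in
theorem clm_ext {Y : Type} [NormedAddCommGroup Y] [NormedSpace ℂ Y] {A B : EllOne ι →L[ℂ] Y}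
    (h : ∀ i, A (unitVec i) = B (unitVec i)) : A = B := by
  refine lp.ext_continuousLinearMap (by simp) fun i => ?_
  ext
  simpa [lp.singleContinuousLinearMap_apply, unitVec] using h i

variable {Y : Type} [NormedAddCommGroup Y] [NormedSpace ℂ Y] [CompleteSpace Y]

theorem summable_smul (a : EllOne ι) {y : ι → Y} (hy : ∀ i, ‖y i‖ ≤ 1) :
    Summable fun i => a i • y i := by
  refine Summable.of_norm_bounded (summable_norm a) fun i => ?_
  rw [norm_smul]
  exact mul_le_of_le_one_right (norm_nonneg _) (hy i)

open Classical in
/-- The continuous linear map on `ℓ¹` with prescribed values, in the unit ball, on the standard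
unit vectors (and `0` if some prescribed value is outside the unit ball). -/
def lift (y : ι → Y) : EllOne ι →L[ℂ] Y :=
  if hy : ∀ i, ‖y i‖ ≤ 1 then
    LinearMap.mkContinuous
      { toFun := fun a => ∑' i, a i • y i
        map_add' := fun a b => by
          rw [← (summable_smul a hy).tsum_add (summable_smul b hy)]
          simp [add_smul]
        map_smul' := fun c a => by
          rw [RingHom.id_apply, ← (summable_smul a hy).tsum_const_smul]
          simp [mul_smul] }
      1 fun a => by
        rw [one_mul, norm_eq_tsum]
        refine tsum_of_norm_bounded (summable_norm a).hasSum fun i => ?_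
        rw [norm_smul]
        exact mul_le_of_le_one_right (norm_nonneg _) (hy i)
  else 0

theorem lift_apply {y : ι → Y} (hy : ∀ i, ‖y i‖ ≤ 1) (a : EllOne ι) :
    lift y a = ∑' i, a i • y i := by
  rw [lift, dif_pos hy]; rfl

theorem norm_lift_le (y : ι → Y) : ‖lift y‖ ≤ 1 := by
  classical
  unfold lift
  split_ifs with hy
  · exact LinearMap.mkContinuous_norm_le _ zero_le_one _
  · simp

theorem lift_unitVec {y : ι → Y} (hy : ∀ i, ‖y i‖ ≤ 1) (i : ι) : lift y (unitVec i) = y i := by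
  classical
  rw [lift_apply hy, tsum_eq_single i]
  · simp [unitVec_apply]
  · intro j hj
    simp [unitVec_apply, hj]

open Classical in
/-- The coordinate functionals on `ℓ¹`. -/
def coord (i : ι) : EllOne ι →L[ℂ] ℂ := lift fun j => if j = i then 1 else 0

theorem coord_apply (i : ι) (a : EllOne ι) : coord i a = a i := by
  classical
  rw [coord, lift_apply fun j => by split_ifs <;> simp, tsum_eq_single i]
  · simp
  · intro j hj
    simp [hj]

/-- The monomial `z ^ α`. -/
def mono {n : ℕ} (z : Cn n) (α : Fin n → ℕ) : ℂ := ∏ i, z i ^ α i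

theorem mono_zero {n : ℕ} (z : Cn n) : mono z 0 = 1 := by simp [mono]

theorem mono_add {n : ℕ} (z : Cn n) (α β : Fin n → ℕ) :
    mono z (α + β) = mono z α * mono z β := by
  simp [mono, pow_add, Finset.prod_mul_distrib]

theorem mono_mul {n : ℕ} (z w : Cn n) (α : Fin n → ℕ) :
    mono (z * w) α = mono z α * mono w α := by
  simp [mono, mul_pow, Finset.prod_mul_distrib]

theorem mono_succ {n : ℕ} (z : Cn (n + 1)) (α : Fin (n + 1) → ℕ) :
    mono z α = z 0 ^ α 0 * mono (Fin.tail z) (Fin.tail α) := by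
  simp [mono, Fin.prod_univ_succ, Fin.tail]

theorem norm_mono_le {n : ℕ} {z : Cn n} (hz : ‖z‖ ≤ 1) (α : Fin n → ℕ) : ‖mono z α‖ ≤ 1 := by
  rw [mono, norm_prod]
  refine Finset.prod_le_one (fun _ _ => norm_nonneg _) fun i _ => ?_
  rw [norm_pow]
  exact pow_le_one₀ (norm_nonneg _) ((norm_le_pi_norm z i).trans hz)

theorem norm_mul_le_one {n : ℕ} {s z : Cn n} (hs : ‖s‖ ≤ 1) (hz : ‖z‖ ≤ 1) : ‖s * z‖ ≤ 1 :=
  (norm_mul_le s z).trans (mul_le_one₀ hs (norm_nonneg _) hz)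

theorem norm_tail_le {n : ℕ} {z : Cn (n + 1)} (hz : ‖z‖ ≤ 1) : ‖(Fin.tail z : Cn n)‖ ≤ 1 :=
  (pi_norm_le_iff_of_nonneg zero_le_one).2 fun i => (norm_le_pi_norm z i.succ).trans hz

/-- Evaluation of the power series with coefficients `a` at a point of the closed polydisc. -/
def ev {n : ℕ} (z : Cn n) : EllOne (Fin n → ℕ) →L[ℂ] ℂ := lift (mono z)

theorem ev_unitVec {n : ℕ} {z : Cn n} (hz : ‖z‖ ≤ 1) (α : Fin n → ℕ) :
    ev z (unitVec α) = mono z α := lift_unitVec (norm_mono_le hz) α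

theorem ev_zero {n : ℕ} (a : EllOne (Fin n → ℕ)) : ev 0 a = a 0 := by
  rw [ev, lift_apply (norm_mono_le (by simp)), tsum_eq_single 0]
  · simp [mono_zero]
  · intro α hα
    obtain ⟨i, hi⟩ := Function.ne_iff.1 hα
    have : mono (0 : Cn n) α = 0 := Finset.prod_eq_zero (Finset.mem_univ i) (by simpa using hi)
    simp [this]

/-- Multiplication of absolutely convergent power series. -/
def mulL {n : ℕ} : EllOne (Fin n → ℕ) →L[ℂ] EllOne (Fin n → ℕ) →L[ℂ] EllOne (Fin n → ℕ) :=
  lift fun α => lift fun β => unitVec (α + β)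

theorem mulL_unitVec {n : ℕ} (α β : Fin n → ℕ) :
    mulL (unitVec α) (unitVec β) = unitVec (α + β) := by
  rw [mulL, lift_unitVec fun _ => norm_lift_le _, lift_unitVec fun _ => (norm_unitVec _).le]

theorem norm_mulL_le {n : ℕ} (a : EllOne (Fin n → ℕ)) : ‖mulL a‖ ≤ ‖a‖ :=
  (mulL.le_opNorm a).trans (mul_le_of_le_one_left (norm_nonneg _) (norm_lift_le _))

theorem ev_mulL {n : ℕ} {z : Cn n} (hz : ‖z‖ ≤ 1) (a b : EllOne (Fin n → ℕ)) :
    ev z (mulL a b) = ev z a * ev z b := by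
  have h₁ (α : Fin n → ℕ) : (ev z).comp (mulL (unitVec α)) = mono z α • ev z := clm_ext fun β => by
    rw [ContinuousLinearMap.comp_apply, mulL_unitVec, ev_unitVec hz, smul_apply,
      ev_unitVec hz, mono_add, smul_eq_mul]
  have h₂ : (ev z).comp (mulL.flip b) = ev z b • ev z := clm_ext fun α => by
    have := DFunLike.congr_fun (h₁ α) b
    rw [ContinuousLinearMap.comp_apply, smul_apply] at this
    rw [ContinuousLinearMap.comp_apply, ContinuousLinearMap.flip_apply, this,
      smul_apply, ev_unitVec hz, smul_eq_mul, smul_eq_mul, mul_comm]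
  have := DFunLike.congr_fun h₂ a
  rwa [ContinuousLinearMap.comp_apply, smul_apply, smul_eq_mul, mul_comm] at this

/-- The change of variables `z ↦ s * z` on power series. -/
def scale {n : ℕ} (s : Cn n) : EllOne (Fin n → ℕ) →L[ℂ] EllOne (Fin n → ℕ) :=
  lift fun α => mono s α • unitVec α

theorem norm_smul_unitVec_le {c : ℂ} (hc : ‖c‖ ≤ 1) (i : ι) : ‖c • unitVec i‖ ≤ 1 := by
  rwa [norm_smul, norm_unitVec, mul_one]

theorem ev_scale {n : ℕ} {s z : Cn n} (hs : ‖s‖ ≤ 1) (hz : ‖z‖ ≤ 1) (a : EllOne (Fin n → ℕ)) :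
    ev z (scale s a) = ev (s * z) a := by
  have h : (ev z).comp (scale s) = ev (s * z) := clm_ext fun α => by
    rw [ContinuousLinearMap.comp_apply, scale,
      lift_unitVec fun β => norm_smul_unitVec_le (norm_mono_le hs β) β, map_smul,
      ev_unitVec hz, ev_unitVec (norm_mul_le_one hs hz), mono_mul, smul_eq_mul]
  exact DFunLike.congr_fun h a

theorem scale_apply {n : ℕ} {s : Cn n} (hs : ‖s‖ ≤ 1) (a : EllOne (Fin n → ℕ))
    (α : Fin n → ℕ) : scale s a α = mono s α * a α := by
  have h : (coord α).comp (scale s) = mono s α • coord α := clm_ext fun β => by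
    rw [ContinuousLinearMap.comp_apply, scale,
      lift_unitVec fun β => norm_smul_unitVec_le (norm_mono_le hs β) β, map_smul,
      smul_apply, coord_apply, unitVec_apply, smul_eq_mul, smul_eq_mul]
    split_ifs with h
    · rw [h]
    · simp
  simpa [coord_apply] using DFunLike.congr_fun h a

end EllOne

namespace EllOne

section Analytic

variable {n : ℕ}

open Classical in
/-- Evaluation of the part of a power series that only involves the variables in `U`. -/
def partialEv (U : Finset (Fin n)) (z : Cn n) : EllOne (Fin n → ℕ) →L[ℂ] ℂ :=
  lift fun α => if ∀ i ∉ U, α i = 0 then mono z α else 0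

/-- The backward shift in the variable `i`. -/
def backShift (i : Fin n) : EllOne (Fin n → ℕ) →L[ℂ] EllOne (Fin n → ℕ) :=
  lift fun α => if α i = 0 then 0 else unitVec (Function.update α i (α i - 1))

theorem partialEv_unitVec (U : Finset (Fin n)) {z : Cn n} (hz : ‖z‖ ≤ 1) (α : Fin n → ℕ)
    [Decidable (∀ i ∉ U, α i = 0)] :
    partialEv U z (unitVec α) = if ∀ i ∉ U, α i = 0 then mono z α else 0 := by
  rw [partialEv, lift_unitVec]
  · congr
  · intro β
    split_ifs
    · exact norm_mono_le hz β
    · simp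

theorem backShift_unitVec (i : Fin n) (α : Fin n → ℕ) :
    backShift i (unitVec α) =
      if α i = 0 then 0 else unitVec (Function.update α i (α i - 1)) := by
  rw [backShift, lift_unitVec]
  intro β
  split_ifs
  · simp
  · rw [norm_unitVec]

theorem mono_eq_mul_update (z : Cn n) {α : Fin n → ℕ} {i : Fin n} (h : α i ≠ 0) :
    mono z α = z i * mono z (Function.update α i (α i - 1)) := by
  rw [mono, mono, ← Finset.mul_prod_erase _ _ (Finset.mem_univ i),
    ← Finset.mul_prod_erase _ _ (Finset.mem_univ i), ← mul_assoc, Function.update_self, ← pow_succ',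
    Nat.sub_add_cancel (Nat.one_le_iff_ne_zero.2 h)]
  congr 1
  refine Finset.prod_congr rfl fun j hj => ?_
  rw [Function.update_of_ne (Finset.ne_of_mem_erase hj)]

theorem partialEv_insert_comp {U : Finset (Fin n)} {i : Fin n} (hi : i ∉ U) {z : Cn n}
    (hz : ‖z‖ ≤ 1) :
    (partialEv (insert i U) z).comp (1 - z i • backShift i) = partialEv U z := by
  classical
  refine clm_ext fun α => ?_
  rw [ContinuousLinearMap.comp_apply, sub_apply, smul_apply, one_apply_eq_self, map_sub, map_smul,
    backShift_unitVec, partialEv_unitVec _ hz, partialEv_unitVec _ hz]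
  by_cases h0 : α i = 0
  · rw [if_pos h0, map_zero, smul_zero, sub_zero]
    refine if_congr ⟨fun h j hj => ?_, fun h j hj => h j fun hjU => hj (by simp [hjU])⟩ rfl rfl
    by_cases hji : j = i
    · rw [hji, h0]
    · exact h j (by simp [hji, hj])
  · rw [if_neg h0, partialEv_unitVec _ hz,
      if_neg (show ¬∀ j ∉ U, α j = 0 from fun h => h0 (h i hi))]
    have : (∀ j ∉ insert i U, Function.update α i (α i - 1) j = 0) ↔
        ∀ j ∉ insert i U, α j = 0 := by
      refine forall₂_congr fun j hj => ?_
      rw [Function.update_of_ne]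
      rintro rfl
      exact hj (Finset.mem_insert_self _ _)
    by_cases h : ∀ j ∉ insert i U, α j = 0
    · rw [if_pos h, if_pos (this.2 h), mono_eq_mul_update z h0, smul_eq_mul, sub_self]
    · rw [if_neg h, if_neg (mt this.1 h), smul_zero, sub_self]

theorem analyticAt_partialEv (U : Finset (Fin n)) : AnalyticAt ℂ (partialEv U) 0 := by
  classical
  induction U using Finset.induction_on with
  | empty =>
    refine (analyticAt_const (v := partialEv ∅ (0 : Cn n))).congr ?_
    refine Filter.Eventually.of_forall fun z => ?_
    unfold partialEv
    refine congrArg lift (funext fun α => ?_)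
    split_ifs with h
    · obtain rfl : α = 0 := funext fun i => h i (Finset.notMem_empty i)
      simp [mono_zero]
    · rfl
  | insert i U hi ih =>
    have hB : AnalyticAt ℂ (fun z : Cn n => 1 - z i • backShift i) 0 :=
      analyticAt_const.sub
        (((ContinuousLinearMap.proj (R := ℂ) (φ := fun _ : Fin n => ℂ) i).analyticAt 0).smul
          analyticAt_const)
    have hinv : AnalyticAt ℂ (fun z : Cn n => Ring.inverse (1 - z i • backShift i)) 0 := by
      refine AnalyticAt.fun_comp (g := Ring.inverse) ?_ hB
      have : (1 : EllOne (Fin n → ℕ) →L[ℂ] EllOne (Fin n → ℕ)) - (0 : Cn n) i • backShift i =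
          (1 : (EllOne (Fin n → ℕ) →L[ℂ] EllOne (Fin n → ℕ))ˣ) := by simp
      rw [this]
      exact analyticAt_inverse _
    have hcomp : AnalyticAt ℂ (fun z : Cn n =>
        (partialEv U z).comp (Ring.inverse (1 - z i • backShift i))) 0 :=
      ((ContinuousLinearMap.compL ℂ (EllOne (Fin n → ℕ)) (EllOne (Fin n → ℕ)) ℂ).analyticAt_bilinear
        (partialEv U 0, _)).comp₂ ih hinv
    refine hcomp.congr ?_
    have hunit : ∀ᶠ z : Cn n in 𝓝 0, IsUnit (1 - z i • backShift i) :=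
      hB.continuousAt.eventually_mem (Units.isOpen.mem_nhds (by simp))
    filter_upwards [hunit, Metric.closedBall_mem_nhds (0 : Cn n) one_pos] with z hz hz1
    rw [mem_closedBall_zero_iff] at hz1
    rw [← partialEv_insert_comp hi hz1, ContinuousLinearMap.comp_assoc]
    have := Ring.mul_inverse_cancel _ hz
    rw [ContinuousLinearMap.mul_def] at this
    rw [this]
    rfl

theorem analyticAt_ev (a : EllOne (Fin n → ℕ)) : AnalyticAt ℂ (fun z => ev z a) 0 := by
  have h := ((ContinuousLinearMap.apply ℂ ℂ a).analyticAt _).fun_comp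
    (analyticAt_partialEv (Finset.univ : Finset (Fin n)))
  simpa [partialEv, ev] using h

theorem exists_ev_eq {f : Cn n → ℂ} (hf : AnalyticAt ℂ f 0) :
    ∃ ρ₀ > 0, ∀ ρ : ℝ, 0 < ρ → ρ ≤ ρ₀ →
      ∃ a : EllOne (Fin n → ℕ), ∀ z : Cn n, ‖z‖ ≤ 1 → f ((ρ : ℂ) • z) = ev z a := by
  obtain ⟨p, r, hp⟩ := hf
  obtain ⟨R, hR0, hRr⟩ := ENNReal.lt_iff_exists_nnreal_btwn.1 hp.r_pos
  have hR0 : 0 < (R : ℝ) := by simpa using hR0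
  refine ⟨R / (n + 1), by positivity, fun ρ hρ hρR => ?_⟩
  rw [le_div_iff₀ (by positivity)] at hρR
  let I := Σ m : ℕ, Fin m → Fin n
  let c : I → ℂ := fun i => p i.1 fun j => Pi.single (i.2 j) 1
  let cnt : I → Fin n → ℕ := fun i l => (Finset.univ.filter fun j => i.2 j = l).card
  have hmono (z : Cn n) (i : I) : mono z (cnt i) = ∏ j, z (i.2 j) := by
    simp only [mono, cnt]
    rw [← Finset.prod_fiberwise (s := Finset.univ) (g := i.2)]
    refine Finset.prod_congr rfl fun l _ => ?_
    rw [Finset.prod_congr rfl (g := fun _ => z l), Finset.prod_const]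
    intro j hj
    rw [(Finset.mem_filter.1 hj).2]
  have hc (i : I) : ‖c i‖ ≤ ‖p i.1‖ := by
    refine ((p i.1).le_opNorm _).trans ?_
    refine mul_le_of_le_one_right (norm_nonneg _)
      (Finset.prod_le_one (fun _ _ => norm_nonneg _) fun j _ => ?_)
    rw [Pi.norm_single]; simp
  have hpsum : Summable fun m => ‖p m‖ * (R : ℝ) ^ m :=
    p.summable_norm_mul_pow (hRr.trans_le hp.r_le)
  have hsumI : Summable fun i : I => ρ ^ i.1 * ‖p i.1‖ := by
    rw [summable_sigma_of_nonneg fun i => by positivity]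
    refine ⟨fun m => Summable.of_finite, Summable.of_nonneg_of_le
      (fun m => tsum_nonneg fun _ => by positivity) (fun m => ?_) hpsum⟩
    have hcard : ∑' _ : Fin m → Fin n, ρ ^ m * ‖p m‖ = (n : ℝ) ^ m * (ρ ^ m * ‖p m‖) := by
      simp [tsum_fintype]
    refine hcard.le.trans ?_
    rw [← mul_assoc, ← mul_pow, mul_comm (‖p m‖)]
    gcongr
    nlinarith
  have hsumE : Summable fun i : I => ((ρ : ℂ) ^ i.1 * c i) • unitVec (cnt i) := by
    refine Summable.of_norm_bounded hsumI fun i => ?_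
    rw [norm_smul, norm_unitVec, mul_one, norm_mul, norm_pow, Complex.norm_real,
      Real.norm_of_nonneg hρ.le]
    gcongr
    exact hc i
  refine ⟨∑' i, ((ρ : ℂ) ^ i.1 * c i) • unitVec (cnt i), fun z hz => ?_⟩
  have hev : HasSum (fun i : I => (ρ : ℂ) ^ i.1 * c i * ∏ j, z (i.2 j))
      (ev z (∑' i, ((ρ : ℂ) ^ i.1 * c i) • unitVec (cnt i))) := by
    have := hsumE.hasSum.mapL (ev z)
    simpa only [map_smul, ev_unitVec hz, hmono, smul_eq_mul] using this
  have hmem : (ρ : ℂ) • z ∈ Metric.eball (0 : Cn n) r := by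
    have hle : ‖(ρ : ℂ) • z‖₊ ≤ R := by
      rw [← NNReal.coe_le_coe, coe_nnnorm, norm_smul, Complex.norm_real, Real.norm_of_nonneg hρ.le]
      nlinarith [norm_nonneg z, mul_nonneg hρ.le (Nat.cast_nonneg (α := ℝ) n)]
    rw [Metric.mem_eball, edist_zero_right]
    exact (ENNReal.coe_le_coe.2 hle).trans_lt hRr
  have hfs := hp.hasSum hmem
  rw [zero_add] at hfs
  refine hfs.unique ?_
  have hfib := hev.sigma fun m => hasSum_fintype _
  refine hfib.congr_fun fun m => ?_
  have hz' : (fun _ : Fin m => (ρ : ℂ) • z) =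
      fun _ => ∑ l, ((ρ : ℂ) * z l) • (Pi.single l 1 : Cn n) := by
    funext _
    ext l
    simp [Finset.sum_apply, Pi.single_apply]
  rw [hz', (p m).map_sum]
  refine Finset.sum_congr rfl fun i _ => ?_
  rw [(p m).map_smul_univ, Finset.prod_mul_distrib]
  simp only [c, Finset.prod_const, Finset.card_univ, Fintype.card_fin, smul_eq_mul]
  ring

end Analytic

end EllOne

namespace EllOne

section Division

variable {n : ℕ}

/-- The quotient of a power series by the `k`-th power of the first variable. -/
def divPow (k : ℕ) : EllOne (Fin (n + 1) → ℕ) →L[ℂ] EllOne (Fin (n + 1) → ℕ) :=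
  lift fun α => if k ≤ α 0 then unitVec (Fin.cons (α 0 - k) (Fin.tail α)) else 0

/-- The coefficient of the `j`-th power of the first variable in a power series. -/
def coeffVar (j : ℕ) : EllOne (Fin (n + 1) → ℕ) →L[ℂ] EllOne (Fin n → ℕ) :=
  lift fun α => if α 0 = j then unitVec (Fin.tail α) else 0

theorem divPow_unitVec (k : ℕ) (α : Fin (n + 1) → ℕ) :
    divPow k (unitVec α) =
      if k ≤ α 0 then unitVec (Fin.cons (α 0 - k) (Fin.tail α)) else 0 := by
  rw [divPow, lift_unitVec]
  intro β
  split_ifs <;> simp [norm_unitVec]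

theorem coeffVar_unitVec (j : ℕ) (α : Fin (n + 1) → ℕ) :
    coeffVar j (unitVec α) = if α 0 = j then unitVec (Fin.tail α) else 0 := by
  rw [coeffVar, lift_unitVec]
  intro β
  split_ifs <;> simp [norm_unitVec]

theorem coeffVar_apply (j : ℕ) (a : EllOne (Fin (n + 1) → ℕ)) (β : Fin n → ℕ) :
    coeffVar j a β = a (Fin.cons j β) := by
  have h : (coord β).comp (coeffVar j) = coord (Fin.cons j β : Fin (n + 1) → ℕ) :=
    clm_ext fun α => by
      rw [ContinuousLinearMap.comp_apply, coeffVar_unitVec, coord_apply, coord_apply, unitVec_apply]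
      have hiff : Fin.cons j β = α ↔ α 0 = j ∧ β = Fin.tail α := by
        constructor
        · rintro rfl
          exact ⟨rfl, rfl⟩
        · rintro ⟨rfl, rfl⟩
          exact Fin.cons_self_tail α
      by_cases hα : α 0 = j
      · rw [if_pos hα, unitVec_apply]
        simp [hiff, hα]
      · rw [if_neg hα, if_neg (by simp [hiff, hα])]
        rfl
  simpa [coord_apply] using DFunLike.congr_fun h a

theorem ev_eq_divPow_add (k : ℕ) {z : Cn (n + 1)} (hz : ‖z‖ ≤ 1)
    (a : EllOne (Fin (n + 1) → ℕ)) :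
    ev z a = z 0 ^ k * ev z (divPow k a) +
      ∑ j : Fin k, z 0 ^ (j : ℕ) * ev (Fin.tail z : Cn n) (coeffVar j a) := by
  have h : ev z = z 0 ^ k • (ev z).comp (divPow k) +
      ∑ j : Fin k, z 0 ^ (j : ℕ) • (ev (Fin.tail z : Cn n)).comp (coeffVar j) := clm_ext fun α => by
    simp only [add_apply, smul_apply, sum_apply, ContinuousLinearMap.comp_apply, smul_eq_mul,
      divPow_unitVec, coeffVar_unitVec]
    rw [ev_unitVec hz, mono_succ]
    by_cases hk : k ≤ α 0
    · rw [if_pos hk, ev_unitVec hz, mono_succ, Fin.cons_zero, Fin.tail_cons, ← mul_assoc, ← pow_add,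
        Nat.add_sub_cancel' hk, Finset.sum_eq_zero, add_zero]
      intro j _
      rw [if_neg (by omega), map_zero, mul_zero]
    · rw [if_neg hk, map_zero, mul_zero, zero_add,
        Finset.sum_eq_single (⟨α 0, not_le.1 hk⟩ : Fin k)]
      · rw [if_pos rfl, ev_unitVec (norm_tail_le hz)]
      · intro j _ hj
        rw [if_neg fun h => hj (Fin.ext h.symm), map_zero, mul_zero]
      · simp
  simpa using DFunLike.congr_fun h a

/-- The power series `a` is regular of order `k` in the first variable. -/
def IsRegular (k : ℕ) (a : EllOne (Fin (n + 1) → ℕ)) : Prop :=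
  (∀ j < k, a (Fin.cons j 0) = 0) ∧ a (Fin.cons k 0) ≠ 0

theorem mono_ne_zero {s : Cn n} (hs : ∀ i, s i ≠ 0) (α : Fin n → ℕ) : mono s α ≠ 0 :=
  Finset.prod_ne_zero_iff.2 fun i _ => pow_ne_zero _ (hs i)

theorem isRegular_scale {k : ℕ} {a : EllOne (Fin (n + 1) → ℕ)} (ha : IsRegular k a)
    {s : Cn (n + 1)} (hs : ‖s‖ ≤ 1) (hs0 : ∀ i, s i ≠ 0) : IsRegular k (scale s a) := by
  refine ⟨fun j hj => ?_, ?_⟩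
  · rw [scale_apply hs, ha.1 j hj, mul_zero]
  · rw [scale_apply hs]
    exact mul_ne_zero (mono_ne_zero hs0 _) ha.2

theorem norm_tail_mono_le {ε : ℝ} (hε : 0 < ε) (hε1 : ε ≤ 1) (k : ℕ) {β : Fin n → ℕ} (hβ : β ≠ 0) :
    ‖mono (fun _ => ((ε : ℂ) ^ (k + 1)) : Cn n) β‖ ≤ ε ^ (k + 1) := by
  obtain ⟨i, hi⟩ := Function.ne_iff.1 hβ
  rw [mono, norm_prod, ← Finset.mul_prod_erase _ _ (Finset.mem_univ i)]
  simp only [norm_pow, Complex.norm_real, Real.norm_of_nonneg hε.le]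
  refine (mul_le_of_le_one_right (by positivity) ?_).trans (?_ : _ ≤ ε ^ (k + 1))
  rotate_left
  · exact pow_le_of_le_one (by positivity) (pow_le_one₀ hε.le hε1) hi
  · exact Finset.prod_le_one (fun _ _ => by positivity)
      fun _ _ => pow_le_one₀ (by positivity) (pow_le_one₀ hε.le hε1)

theorem exists_scale_near_unitVec {k : ℕ} {a : EllOne (Fin (n + 1) → ℕ)} (ha : IsRegular k a) :
    ∃ s : Cn (n + 1), ‖s‖ ≤ 1 ∧ (∀ i, s i ≠ 0) ∧ ∃ c : ℂ, c ≠ 0 ∧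
      ‖c • scale s a - unitVec (Fin.cons k 0)‖ < 1 := by
  set A := a (Fin.cons k 0) with hA
  have hA0 : 0 < ‖A‖ := norm_pos_iff.2 ha.2
  obtain ⟨ε, hε, hε1, hεA⟩ : ∃ ε : ℝ, 0 < ε ∧ ε ≤ 1 ∧ ε * (‖a‖ / ‖A‖) < 1 := by
    refine ⟨min 1 (‖a‖ / ‖A‖ + 1)⁻¹, by positivity, min_le_left _ _, ?_⟩
    calc _ ≤ (‖a‖ / ‖A‖ + 1)⁻¹ * (‖a‖ / ‖A‖) := by gcongr; exact min_le_right _ _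
      _ < 1 := by rw [inv_mul_lt_iff₀ (by positivity)]; linarith
  have hεC : (ε : ℂ) ≠ 0 := by exact_mod_cast hε.ne'
  let s : Cn (n + 1) := Fin.cons (ε : ℂ) fun _ => (ε : ℂ) ^ (k + 1)
  have hs : ‖s‖ ≤ 1 := by
    refine (pi_norm_le_iff_of_nonneg zero_le_one).2 fun i => ?_
    refine Fin.cases ?_ (fun i => ?_) i
    · simpa [s, abs_of_pos hε] using hε1
    · simpa [s, abs_of_pos hε] using pow_le_one₀ hε.le hε1
  refine ⟨s, hs, fun i => ?_, ((ε : ℂ) ^ k * A)⁻¹, inv_ne_zero (mul_ne_zero (pow_ne_zero _ hεC) ha.2),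
    ?_⟩
  · refine Fin.cases ?_ (fun i => ?_) i <;> simp [s, hε.ne']
  set x := ((ε : ℂ) ^ k * A)⁻¹ • EllOne.scale s a - unitVec (Fin.cons k 0) with hx
  have hxa (α) : ‖x α‖ ≤ ε / ‖A‖ * ‖a α‖ := by
    have hxα : x α = ((ε : ℂ) ^ k * A)⁻¹ * (mono s α * a α) -
        (unitVec (Fin.cons k 0) : EllOne (Fin (n + 1) → ℕ)) α := by
      rw [hx, ← scale_apply hs]; rfl
    by_cases hα : α = Fin.cons k 0
    · have : x α = 0 := by
        rw [hxα, unitVec_apply, if_pos hα, hα, ← hA, mono_succ,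
          show Fin.tail (Fin.cons k 0 : Fin (n + 1) → ℕ) = 0 from rfl, mono_zero, mul_one]
        exact sub_eq_zero.2 (inv_mul_cancel₀ (mul_ne_zero (pow_ne_zero _ hεC) ha.2))
      rw [this, norm_zero]
      positivity
    rw [hxα, unitVec_apply, if_neg hα, sub_zero]
    have key : a α = 0 ∨ ‖mono s α‖ ≤ ε ^ (k + 1) := by
      rw [mono_succ, norm_mul, norm_pow]
      simp only [s, Fin.cons_zero, Fin.tail_cons, Complex.norm_real, Real.norm_of_nonneg hε.le]
      by_cases ht : Fin.tail α = 0
      · rw [ht, mono_zero, norm_one, mul_one]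
        have hα' : α = Fin.cons (α 0) 0 := by rw [← ht, Fin.cons_self_tail]
        rcases lt_trichotomy (α 0) k with h | h | h
        · exact Or.inl (by rw [hα']; exact ha.1 _ h)
        · exact absurd (by rw [hα', h]) hα
        · exact Or.inr (pow_le_pow_of_le_one hε.le hε1 h)
      · exact Or.inr ((mul_le_of_le_one_left (norm_nonneg _) (pow_le_one₀ hε.le hε1)).trans
          (norm_tail_mono_le hε hε1 k ht))
    rcases key with h0 | h
    · simp [h0]
    rw [← mul_assoc, norm_mul]
    gcongr
    rw [norm_mul, norm_inv, norm_mul, norm_pow, Complex.norm_real, Real.norm_of_nonneg hε.le,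
      inv_mul_le_iff₀ (by positivity)]
    refine h.trans_eq ?_
    field_simp
    rw [pow_succ]
  calc ‖x‖ = ∑' α, ‖x α‖ := norm_eq_tsum x
    _ ≤ ∑' α, ε / ‖A‖ * ‖a α‖ := (summable_norm x).tsum_le_tsum hxa ((summable_norm a).mul_left _)
    _ = ε / ‖A‖ * ‖a‖ := by rw [tsum_mul_left, ← norm_eq_tsum]
    _ < 1 := by rwa [div_mul_eq_mul_div, mul_div_assoc]

theorem exists_divPow_mulL_eq {k : ℕ} {g : EllOne (Fin (n + 1) → ℕ)}
    (hg : ‖g - unitVec (Fin.cons k 0)‖ < 1) (b : EllOne (Fin (n + 1) → ℕ)) :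
    ∃ q, divPow k (mulL g q) = divPow k b := by
  let E := (divPow k).comp (mulL (unitVec (Fin.cons k 0) - g))
  have hE : ‖E‖ < 1 := by
    refine (ContinuousLinearMap.opNorm_comp_le _ _).trans_lt ?_
    refine (mul_le_of_le_one_left (norm_nonneg _) (norm_lift_le _)).trans_lt ?_
    refine (norm_mulL_le _).trans_lt ?_
    rwa [norm_sub_rev]
  have hid : (divPow k).comp (mulL (unitVec (Fin.cons k 0))) =
      ContinuousLinearMap.id ℂ (EllOne (Fin (n + 1) → ℕ)) := clm_ext fun α => by
    rw [ContinuousLinearMap.comp_apply, mulL_unitVec, divPow_unitVec, Pi.add_apply, Fin.cons_zero,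
      if_pos (Nat.le_add_right _ _), Nat.add_sub_cancel_left, ContinuousLinearMap.id_apply]
    congr 1
    conv_rhs => rw [← Fin.cons_self_tail α]
    congr 1
    funext i
    simp [Fin.tail]
  have hE' : (divPow k).comp (mulL g) = ((Units.oneSub E hE : (_ →L[ℂ] _)ˣ) : _ →L[ℂ] _) := by
    rw [Units.val_oneSub, ContinuousLinearMap.one_def, ← hid]
    simp [E, ContinuousLinearMap.comp_sub]
  refine ⟨((Units.oneSub E hE)⁻¹ : (_ →L[ℂ] _)ˣ).val (divPow k b), ?_⟩
  rw [← ContinuousLinearMap.comp_apply, hE', ← mul_apply_eq_comp, Units.mul_inv]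
  rfl

end Division

end EllOne

namespace EllOne

variable {n : ℕ}

theorem ev_cons_zero_eq_zero {a : EllOne (Fin (n + 1) → ℕ)}
    (ha : ∀ j, a (Fin.cons j 0) = 0) {t : ℂ} (ht : ‖(Fin.cons t 0 : Cn (n + 1))‖ ≤ 1) :
    ev (Fin.cons t 0 : Cn (n + 1)) a = 0 := by
  rw [ev, lift_apply (norm_mono_le ht)]
  refine (tsum_congr fun α => ?_).trans tsum_zero
  by_cases hα : Fin.tail α = 0
  · rw [← Fin.cons_self_tail α, hα, ha, zero_smul]
  · obtain ⟨i, hi⟩ := Function.ne_iff.1 hα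
    rw [mono_succ, Fin.tail_cons, mono, Finset.prod_eq_zero (Finset.mem_univ i), mul_zero,
      smul_zero]
    simpa using hi

theorem analyticAt_ev_mul (τ : Cn n) (a : EllOne (Fin n → ℕ)) :
    AnalyticAt ℂ (fun z => ev (τ * z) a) 0 := by
  have h : AnalyticAt ℂ (fun z => ev z a) (τ * 0) := by
    rw [mul_zero]; exact analyticAt_ev a
  exact AnalyticAt.fun_comp (f := fun z : Cn n => τ * z) (x := 0) h
    (((ContinuousLinearMap.mul ℂ (Cn n)) τ).analyticAt 0)

theorem norm_cons_zero (t : ℂ) : ‖(Fin.cons t 0 : Cn (n + 1))‖ = ‖t‖ := by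
  refine le_antisymm ((pi_norm_le_iff_of_nonneg (norm_nonneg _)).2 fun i => ?_) ?_
  · refine Fin.cases ?_ (fun i => ?_) i <;> simp
  · simpa using norm_le_pi_norm (Fin.cons t 0 : Cn (n + 1)) 0

theorem continuous_cons_zero : Continuous fun t : ℂ => (Fin.cons t 0 : Cn (n + 1)) :=
  continuous_pi fun i => by
    refine Fin.cases ?_ (fun i => ?_) i
    · exact continuous_id
    · simpa using continuous_const

end EllOne

open EllOne in
/-- **Weierstrass division theorem**: a convergent power series that does not vanish identically
on the first coordinate axis is regular of some order `k` in the first variable, and every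
convergent power series can be divided by it with a remainder of degree less than `k`. -/
theorem weierstrass_division {n : ℕ} {g : Cn (n + 1) → ℂ} (hg : AnalyticAt ℂ g 0)
    (hreg : ∃ᶠ t in 𝓝 (0 : ℂ), g (Fin.cons t 0) ≠ 0) :
    ∃ k : ℕ, (∃ u : ℂ → ℂ, ContinuousAt u 0 ∧ ∀ᶠ t in 𝓝 0, g (Fin.cons t 0) = t ^ k * u t) ∧
      ∀ b, AnalyticAt ℂ b 0 → ∃ Q : Cn (n + 1) → ℂ, AnalyticAt ℂ Q 0 ∧
        ∃ r : Fin k → Cn n → ℂ, (∀ j, AnalyticAt ℂ (r j) 0) ∧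
          ∀ᶠ z in 𝓝 0, b z = Q z * g z + ∑ j, r j (Fin.tail z) * z 0 ^ (j : ℕ) := by
  obtain ⟨ρg, hρg, hga⟩ := exists_ev_eq hg
  obtain ⟨a, ha⟩ := hga ρg hρg le_rfl
  have hρgC : (ρg : ℂ) ≠ 0 := by exact_mod_cast hρg.ne'
  have hax : ∀ᶠ t in 𝓝 (0 : ℂ), ‖(Fin.cons (t / ρg) 0 : Cn (n + 1))‖ ≤ 1 ∧
      g (Fin.cons t 0) = ev (Fin.cons (t / ρg) 0) a := by
    filter_upwards [Metric.ball_mem_nhds (0 : ℂ) hρg] with t ht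
    have h1 : ‖(Fin.cons (t / ρg) 0 : Cn (n + 1))‖ ≤ 1 := by
      rw [norm_cons_zero, norm_div, Complex.norm_real, Real.norm_of_nonneg hρg.le, div_le_one hρg]
      exact (mem_ball_zero_iff.1 ht).le
    refine ⟨h1, ?_⟩
    rw [← ha _ h1]
    congr 1
    funext i
    refine Fin.cases ?_ (fun i => ?_) i
    · simp [mul_div_cancel₀ _ hρgC]
    · simp
  have hex : ∃ k, a (Fin.cons k 0) ≠ 0 := by
    by_contra! hcon
    refine hreg ?_
    filter_upwards [hax] with t ht
    rw [not_not, ht.2, ev_cons_zero_eq_zero hcon ht.1]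
  classical
  let k := Nat.find hex
  have hk : IsRegular k a := ⟨fun j hj => not_not.1 (Nat.find_min hex hj), Nat.find_spec hex⟩
  refine ⟨k, ⟨fun t => (ρg : ℂ)⁻¹ ^ k * ev (Fin.cons (t / ρg) 0) (divPow k a), ?_, ?_⟩, ?_⟩
  · refine continuousAt_const.mul ?_
    have h : ContinuousAt (fun z => ev z (divPow k a))
        ((fun t : ℂ => (Fin.cons (t / ρg) 0 : Cn (n + 1))) 0) := by
      have : (fun t : ℂ => (Fin.cons (t / ρg) 0 : Cn (n + 1))) 0 = 0 := by
        funext i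
        refine Fin.cases ?_ (fun i => ?_) i <;> simp
      rw [this]
      exact (analyticAt_ev _).continuousAt
    exact h.comp (f := fun t : ℂ => (Fin.cons (t / ρg) 0 : Cn (n + 1)))
      (continuous_cons_zero.comp (continuous_id.div_const _)).continuousAt
  · filter_upwards [hax] with t ht
    rw [ht.2, ev_eq_divPow_add k ht.1, Finset.sum_eq_zero, add_zero, Fin.cons_zero, div_eq_mul_inv,
      mul_pow, mul_assoc]
    intro j _
    rw [Fin.tail_cons, ev_zero, coeffVar_apply, hk.1 j j.2, mul_zero]
  intro b hb
  obtain ⟨ρb, hρb, hba⟩ := exists_ev_eq hb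
  set ρ := min ρg ρb with hρdef
  have hρ : 0 < ρ := lt_min hρg hρb
  have hρC : (ρ : ℂ) ≠ 0 := by exact_mod_cast hρ.ne'
  obtain ⟨ab, hab⟩ := hba ρ hρ (min_le_right _ _)
  let σ : Cn (n + 1) := fun _ => (ρ : ℂ) / ρg
  have hσ : ‖σ‖ ≤ 1 := by
    refine (pi_norm_le_iff_of_nonneg zero_le_one).2 fun i => ?_
    simp only [σ]
    rw [norm_div, Complex.norm_real, Complex.norm_real, Real.norm_of_nonneg hρg.le,
      Real.norm_of_nonneg hρ.le, div_le_one hρg]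
    exact min_le_left _ _
  have hkσ : IsRegular k (scale σ a) := isRegular_scale hk hσ fun i => div_ne_zero hρC hρgC
  obtain ⟨s, hs, hs0, c, hc, hlt⟩ := exists_scale_near_unitVec hkσ
  obtain ⟨q, hq⟩ := exists_divPow_mulL_eq hlt (scale s ab)
  let d := scale s ab - mulL (c • scale s (scale σ a)) q
  have hd : divPow k d = 0 := by rw [map_sub, hq, sub_self]
  have hz (z : Cn (n + 1)) (hz : ‖z‖ ≤ 1) : b ((ρ : ℂ) • (s * z)) =
      c * g ((ρ : ℂ) • (s * z)) * ev z q +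
        ∑ j : Fin k, z 0 ^ (j : ℕ) * ev (Fin.tail z : Cn n) (coeffVar j d) := by
    have h1 := ev_eq_divPow_add k hz d
    rw [hd, map_zero, mul_zero, zero_add] at h1
    rw [← h1, map_sub, ev_mulL hz, map_smul, ev_scale hs hz, ev_scale hs hz,
      ev_scale hσ (norm_mul_le_one hs hz), ← hab _ (norm_mul_le_one hs hz),
      ← ha _ (norm_mul_le_one hσ (norm_mul_le_one hs hz)), smul_eq_mul]
    have : (ρg : ℂ) • (σ * (s * z)) = (ρ : ℂ) • (s * z) := by
      funext i
      simp only [Pi.smul_apply, Pi.mul_apply, smul_eq_mul, σ]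
      field_simp
    rw [this]
    ring
  let τ : Cn (n + 1) := fun i => ((ρ : ℂ) * s i)⁻¹
  refine ⟨fun w => c * ev (τ * w) q, analyticAt_const.mul (analyticAt_ev_mul τ q),
    fun j y => τ 0 ^ (j : ℕ) * ev (Fin.tail τ * y : Cn n) (coeffVar j d),
    fun j => analyticAt_const.mul (analyticAt_ev_mul _ _), ?_⟩
  have hsmall : ∀ᶠ w in 𝓝 (0 : Cn (n + 1)), ‖τ * w‖ ≤ 1 := by
    have : Tendsto (fun w : Cn (n + 1) => ‖τ * w‖) (𝓝 0) (𝓝 ‖τ * 0‖) :=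
      (continuous_const.mul continuous_id).norm.tendsto 0
    rw [mul_zero, norm_zero] at this
    exact this.eventually_le_const zero_lt_one
  filter_upwards [hsmall] with w hw
  have h := hz (τ * w) hw
  have hw' : (ρ : ℂ) • (s * (τ * w)) = w := by
    funext i
    have := hs0 i
    simp only [Pi.smul_apply, Pi.mul_apply, smul_eq_mul, τ]
    field_simp
  rw [hw'] at h
  rw [h]
  congr 1
  · ring
  · refine Finset.sum_congr rfl fun j _ => ?_
    rw [Pi.mul_apply, mul_pow]
    have : (Fin.tail (τ * w) : Cn n) = Fin.tail τ * Fin.tail w := rfl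
    rw [this]
    ring

/-- The algebra of functions on `ℂⁿ` that are analytic at `0`. -/
def An (n : ℕ) : Subalgebra ℂ (Cn n → ℂ) where
  carrier := {f | AnalyticAt ℂ f 0}
  mul_mem' := fun hf hg => AnalyticAt.mul hf hg
  one_mem' := analyticAt_const
  add_mem' := fun hf hg => AnalyticAt.add hf hg
  zero_mem' := analyticAt_const
  algebraMap_mem' := fun _ => analyticAt_const

namespace An

variable {m n : ℕ}

/-- Evaluation of functions at a point. -/
def evalAt (z : Cn n) : An n →ₐ[ℂ] ℂ := (Pi.evalAlgHom ℂ (fun _ : Cn n => ℂ) z).comp (An n).val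

@[simp] theorem evalAt_apply (z : Cn n) (f : An n) : evalAt z f = f.1 z := rfl

/-- The coordinate functions. -/
def coord (i : Fin n) : An n :=
  ⟨fun z => z i, (ContinuousLinearMap.proj (R := ℂ) (φ := fun _ : Fin n => ℂ) i).analyticAt 0⟩

@[simp] theorem coord_apply (i : Fin n) (z : Cn n) : (coord i).1 z = z i := rfl

/-- Pullback of functions along an analytic map. -/
def pull (G : Cn m → Cn n) (hG : AnalyticAt ℂ G 0) (hG0 : G 0 = 0) : An n →ₐ[ℂ] An m where
  toFun f := ⟨fun z => f.1 (G z), AnalyticAt.fun_comp (by rw [hG0]; exact f.2) hG⟩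
  map_one' := rfl
  map_mul' _ _ := rfl
  map_zero' := rfl
  map_add' _ _ := rfl
  commutes' _ := rfl

/-- Pullback of functions along a linear map. -/
def pullL (L : Cn m →L[ℂ] Cn n) : An n →ₐ[ℂ] An m := pull L (L.analyticAt 0) (map_zero L)

@[simp] theorem pullL_apply (L : Cn m →L[ℂ] Cn n) (f : An n) (z : Cn m) :
    (pullL L f).1 z = f.1 (L z) := rfl

/-- The projection forgetting the first coordinate. -/
def tailL (n : ℕ) : Cn (n + 1) →L[ℂ] Cn n :=
  ContinuousLinearMap.pi fun i => ContinuousLinearMap.proj i.succ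

@[simp] theorem tailL_apply (z : Cn (n + 1)) : tailL n z = Fin.tail z := rfl

theorem analyticAt_pder {f : Cn n → ℂ} {z : Cn n} (hf : AnalyticAt ℂ f z) (i : Fin n) :
    AnalyticAt ℂ (pder f i) z :=
  ((ContinuousLinearMap.apply ℂ ℂ (Pi.single i (1 : ℂ) : Cn n)).analyticAt _).fun_comp hf.fderiv

/-- The partial derivatives of functions. -/
def partialDeriv (i : Fin n) (f : An n) : An n := ⟨pder f.1 i, analyticAt_pder f.2 i⟩

theorem partialDeriv_congr {f g : An n} (h : f.1 =ᶠ[𝓝 0] g.1) (i : Fin n) :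
    (partialDeriv i f).1 =ᶠ[𝓝 0] (partialDeriv i g).1 := by
  filter_upwards [h.fderiv (𝕜 := ℂ)] with z hz
  simp only [partialDeriv, pder, hz]

theorem eventually_differentiableAt (f : An n) : ∀ᶠ z in 𝓝 0, DifferentiableAt ℂ f.1 z := by
  filter_upwards [f.2.eventually_analyticAt] with z hz using hz.differentiableAt

theorem partialDeriv_add (i : Fin n) (f g : An n) :
    (partialDeriv i (f + g)).1 =ᶠ[𝓝 0] (partialDeriv i f + partialDeriv i g).1 := by
  filter_upwards [eventually_differentiableAt f, eventually_differentiableAt g] with z hf hg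
  change fderiv ℂ (f.1 + g.1) z _ = fderiv ℂ f.1 z _ + fderiv ℂ g.1 z _
  rw [fderiv_add hf hg, add_apply]

theorem partialDeriv_mul (i : Fin n) (f g : An n) :
    (partialDeriv i (f * g)).1 =ᶠ[𝓝 0] (f * partialDeriv i g + g * partialDeriv i f).1 := by
  filter_upwards [eventually_differentiableAt f, eventually_differentiableAt g] with z hf hg
  change fderiv ℂ (f.1 * g.1) z _ = f.1 z * fderiv ℂ g.1 z _ + g.1 z * fderiv ℂ f.1 z _
  rw [fderiv_mul hf hg]
  simp

theorem partialDeriv_coord (i j : Fin n) :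
    partialDeriv i (coord j) = if i = j then 1 else 0 := by
  ext z
  have h : fderiv ℂ (fun z : Cn n => z j) z = ContinuousLinearMap.proj j :=
    (ContinuousLinearMap.proj (R := ℂ) (φ := fun _ : Fin n => ℂ) j).fderiv
  change fderiv ℂ (fun z : Cn n => z j) z _ = _
  rw [h, ContinuousLinearMap.proj_apply, Pi.single_apply]
  split_ifs with h1 h2 h2
  · rfl
  · exact absurd h1.symm h2
  · exact absurd h2.symm h1
  · rfl

theorem fderiv_eq_sum_pder (f : Cn n → ℂ) (z v : Cn n) :
    fderiv ℂ f z v = ∑ i, v i * pder f i z := by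
  have hv : v = ∑ i, v i • (Pi.single i (1 : ℂ) : Cn n) := pi_eq_sum_univ' v
  conv_lhs => rw [hv, map_sum]
  simp [pder]

theorem tendsto_zero (L : Cn m →L[ℂ] Cn n) : Tendsto L (𝓝 0) (𝓝 0) := by
  simpa only [map_zero] using L.continuous.tendsto 0

theorem partialDeriv_pullL (L : Cn m →L[ℂ] Cn n) (f : An n) (i : Fin m) :
    (partialDeriv i (pullL L f)).1 =ᶠ[𝓝 0]
      fun z => ∑ j, L (Pi.single i 1) j * (pullL L (partialDeriv j f)).1 z := by
  have hL : Tendsto L (𝓝 0) (𝓝 0) := tendsto_zero L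
  filter_upwards [hL.eventually (eventually_differentiableAt f)] with z hz
  change fderiv ℂ (f.1 ∘ L) z _ = _
  rw [fderiv_comp z hz L.differentiableAt, L.fderiv, ContinuousLinearMap.comp_apply,
    fderiv_eq_sum_pder]
  rfl

/-- A homomorphism that only depends on the germs of functions at `0`. -/
def IsGermHom {R : Type*} [CommRing R] [Algebra ℂ R] (φ : An n →ₐ[ℂ] R) : Prop :=
  ∀ f g : An n, f.1 =ᶠ[𝓝 0] g.1 → φ f = φ g

section

variable {R : Type*} [CommRing R] [Algebra ℂ R] {φ : An n →ₐ[ℂ] R}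

theorem IsGermHom.comp_pull (hφ : IsGermHom φ) {m : ℕ} (G : Cn n → Cn m) (hG : AnalyticAt ℂ G 0)
    (hG0 : G 0 = 0) : IsGermHom (φ.comp (pull G hG hG0)) := fun f g hfg => hφ _ _ <| by
  have hL : Tendsto G (𝓝 0) (𝓝 0) := by simpa [hG0] using hG.continuousAt.tendsto
  exact hL.eventually hfg

theorem IsGermHom.comp_pullL (hφ : IsGermHom φ) {m : ℕ} (L : Cn n →L[ℂ] Cn m) :
    IsGermHom (φ.comp (pullL L)) := hφ.comp_pull _ _ _

theorem IsGermHom.isUnit (hφ : IsGermHom φ) {f : An n} (hf : f.1 0 ≠ 0) : IsUnit (φ f) := by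
  let g : An n := ⟨fun z => (f.1 z)⁻¹, f.2.inv hf⟩
  refine IsUnit.of_mul_eq_one (φ g) ?_
  rw [← map_mul, ← map_one φ]
  refine hφ _ _ ?_
  filter_upwards [f.2.continuousAt.eventually_ne hf] with z hz
  exact mul_inv_cancel₀ hz

end

/-- **The Hadamard lemma**. -/
theorem exists_eq_add_sum (f : An n) : ∃ h : Fin n → An n,
    f.1 =ᶠ[𝓝 0] (algebraMap ℂ (An n) (f.1 0) + ∑ i, coord i * h i).1 := by
  induction n with
  | zero =>
    refine ⟨Fin.elim0, Eventually.of_forall fun z => ?_⟩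
    rw [Subsingleton.elim z 0]
    simp
  | succ n ih =>
    obtain ⟨ρ, hρ, hρa⟩ := EllOne.exists_ev_eq f.2
    obtain ⟨a, ha⟩ := hρa ρ hρ le_rfl
    have hρC : (ρ : ℂ) ≠ 0 := by exact_mod_cast hρ.ne'
    let τ : Cn (n + 1) := fun _ => (ρ : ℂ)⁻¹
    let Q : An (n + 1) := ⟨fun w => (ρ : ℂ)⁻¹ * EllOne.ev (τ * w) (EllOne.divPow 1 a),
      analyticAt_const.mul (EllOne.analyticAt_ev_mul _ _)⟩
    let r : An n := ⟨fun w => EllOne.ev (Fin.tail τ * w : Cn n) (EllOne.coeffVar 0 a),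
      EllOne.analyticAt_ev_mul _ _⟩
    have hfr : f.1 =ᶠ[𝓝 0] (coord 0 * Q + pullL (tailL n) r).1 := by
      have hsmall : ∀ᶠ w in 𝓝 (0 : Cn (n + 1)), ‖τ * w‖ ≤ 1 := by
        have : Tendsto (fun w : Cn (n + 1) => ‖τ * w‖) (𝓝 0) (𝓝 ‖τ * 0‖) :=
          (continuous_const.mul continuous_id).norm.tendsto 0
        rw [mul_zero, norm_zero] at this
        exact this.eventually_le_const zero_lt_one
      filter_upwards [hsmall] with w hw
      have hw' : (ρ : ℂ) • (τ * w) = w := by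
        funext i
        simp only [Pi.smul_apply, Pi.mul_apply, smul_eq_mul, τ]
        field_simp
      have h := ha _ hw
      rw [hw', EllOne.ev_eq_divPow_add 1 hw, Fin.sum_univ_one, Fin.val_zero, pow_zero, one_mul,
        pow_one] at h
      rw [h]
      change _ = w 0 * ((ρ : ℂ)⁻¹ * _) + _
      rw [Pi.mul_apply, mul_comm (τ 0), mul_assoc]
      rfl
    obtain ⟨h, hh⟩ := ih r
    refine ⟨Fin.cons Q fun i => pullL (tailL n) (h i), ?_⟩
    have h0 : f.1 0 = r.1 0 := by
      rw [hfr.eq_of_nhds, ← evalAt_apply, map_add, map_mul, evalAt_apply, coord_apply,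
        Pi.zero_apply, zero_mul, zero_add, evalAt_apply, pullL_apply, map_zero]
    have ht : Tendsto (tailL n) (𝓝 0) (𝓝 0) := tendsto_zero _
    filter_upwards [hfr, ht.eventually hh] with z hz hz'
    simp only [← evalAt_apply, map_add, map_mul, map_sum, AlgHom.commutes, Fin.sum_univ_succ,
      Fin.cons_zero, Fin.cons_succ] at hz hz' ⊢
    have hpull (q : An n) : evalAt z (pullL (tailL n) q) = evalAt (tailL n z) q := rfl
    have hcoord (i : Fin n) : evalAt z (coord i.succ) = evalAt (tailL n z) (coord i) := rfl
    have h0' : evalAt 0 f = evalAt 0 r := h0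
    simp only [hz, hpull, hcoord, hz', h0']
    ring

end An

open Polynomial in
theorem eq_zero_of_sum_eq_pow_mul {k : ℕ} {c : Fin k → ℂ} {v : ℂ → ℂ} (hv : ContinuousAt v 0)
    (h : ∀ᶠ t in 𝓝 0, ∑ j, c j * t ^ (j : ℕ) = t ^ k * v t) : c = 0 := by
  let p : ℂ[X] := ∑ j, C (c j) * X ^ (j : ℕ)
  have hpt (t : ℂ) : p.eval t = ∑ j, c j * t ^ (j : ℕ) := by simp [p, eval_finsetSum]
  have hdeg : p.degree < k := by
    refine (degree_sum_le _ _).trans_lt ((Finset.sup_lt_iff (WithBot.bot_lt_coe k)).2 fun j _ => ?_)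
    exact (degree_C_mul_X_pow_le _ _).trans_lt (Nat.cast_lt.2 j.2)
  have hp : p = 0 := by
    by_contra hp
    obtain ⟨q, hq, hqd⟩ := exists_eq_pow_rootMultiplicity_mul_and_not_dvd p hp 0
    rw [C_0, sub_zero] at hq hqd
    set m := p.rootMultiplicity 0
    have hq0 : q.eval 0 ≠ 0 := by
      rwa [← coeff_zero_eq_eval_zero, Ne, ← X_dvd_iff]
    have hmk : m < k := by
      have h1 : m ≤ p.natDegree := by
        rw [hq, natDegree_mul (pow_ne_zero _ X_ne_zero) (right_ne_zero_of_mul (hq ▸ hp)),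
          natDegree_X_pow]
        exact Nat.le_add_right _ _
      rw [degree_eq_natDegree hp] at hdeg
      exact h1.trans_lt (by exact_mod_cast hdeg)
    have h1 : ∀ᶠ t in 𝓝[≠] (0 : ℂ), q.eval t = t ^ (k - m) * v t := by
      filter_upwards [nhdsWithin_le_nhds h, self_mem_nhdsWithin] with t ht ht0
      rw [← hpt, hq, eval_mul, eval_pow, eval_X] at ht
      refine mul_left_cancel₀ (pow_ne_zero m ht0) ?_
      rw [ht, ← mul_assoc, ← pow_add, Nat.add_sub_cancel' hmk.le]
    have h2 : Tendsto (fun t => q.eval t) (𝓝[≠] 0) (𝓝 (q.eval 0)) :=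
      (q.continuous.tendsto 0).mono_left nhdsWithin_le_nhds
    have h3 : Tendsto (fun t => t ^ (k - m) * v t) (𝓝[≠] 0) (𝓝 (0 ^ (k - m) * v 0)) :=
      (((continuous_pow _).tendsto 0).mul hv.tendsto).mono_left nhdsWithin_le_nhds
    rw [zero_pow (by omega), zero_mul] at h3
    exact hq0 (tendsto_nhds_unique (h2.congr' h1) h3)
  funext j
  have := congrArg (fun q => q.coeff j) hp
  simpa [p, finsetSum_coeff, coeff_X_pow, Fin.val_inj, Finset.sum_ite_eq'] using this

namespace An

variable {n : ℕ}

theorem cons_zero_zero : (Fin.cons 0 0 : Cn (n + 1)) = 0 := by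
  funext i
  refine Fin.cases ?_ (fun i => ?_) i <;> simp

/-- The monic polynomial in the first variable with lower coefficients `-p j`. -/
def monicPoly {k : ℕ} (p : Fin k → An n) : An (n + 1) :=
  coord 0 ^ k - ∑ j, pullL (tailL n) (p j) * coord 0 ^ (j : ℕ)

theorem exists_monicPoly {g : An (n + 1)} (hreg : ∃ᶠ t in 𝓝 (0 : ℂ), g.1 (Fin.cons t 0) ≠ 0) :
    ∃ (k : ℕ) (p : Fin k → An n), (∀ j, (p j).1 0 = 0) ∧
      (∃ Q : An (n + 1), (monicPoly p).1 =ᶠ[𝓝 0] (Q * g).1) ∧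
      ∀ b : An (n + 1), ∃ (Q : An (n + 1)) (r : Fin k → An n), b.1 =ᶠ[𝓝 0]
        (Q * monicPoly p + ∑ j, pullL (tailL n) (r j) * coord 0 ^ (j : ℕ)).1 := by
  obtain ⟨k, ⟨u, hu, hgu⟩, hdiv⟩ := weierstrass_division g.2 hreg
  have hdiv' (b : An (n + 1)) : ∃ (Q : An (n + 1)) (r : Fin k → An n), ∀ᶠ z in 𝓝 0,
      b.1 z = Q.1 z * g.1 z + ∑ j, (r j).1 (Fin.tail z) * z 0 ^ (j : ℕ) := by
    obtain ⟨Q, hQ, r, hr, h⟩ := hdiv b.1 b.2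
    exact ⟨⟨Q, hQ⟩, fun j => ⟨r j, hr j⟩, h⟩
  obtain ⟨Q, p, hp⟩ := hdiv' (coord 0 ^ k)
  have hcons : Tendsto (fun t : ℂ => (Fin.cons t 0 : Cn (n + 1))) (𝓝 0) (𝓝 0) := by
    have := (EllOne.continuous_cons_zero (n := n)).tendsto 0
    rwa [show (Fin.cons 0 0 : Cn (n + 1)) = 0 from cons_zero_zero] at this
  have hQc : ContinuousAt (fun t : ℂ => Q.1 (Fin.cons t 0)) 0 := by
    refine ContinuousAt.comp (g := Q.1) (f := fun t : ℂ => (Fin.cons t 0 : Cn (n + 1))) ?_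
      EllOne.continuous_cons_zero.continuousAt
    rw [show (Fin.cons 0 0 : Cn (n + 1)) = 0 from cons_zero_zero]
    exact Q.2.continuousAt
  have hQu : ContinuousAt (fun t : ℂ => 1 - Q.1 (Fin.cons t 0) * u t) 0 :=
    continuousAt_const.sub (hQc.mul hu)
  have haxis : ∀ᶠ t in 𝓝 (0 : ℂ), ∑ j, (p j).1 0 * t ^ (j : ℕ) =
      t ^ k * (1 - Q.1 (Fin.cons t 0) * u t) := by
    filter_upwards [hcons.eventually hp, hgu] with t h1 h2
    have h3 : t ^ k = Q.1 (Fin.cons t 0) * g.1 (Fin.cons t 0) +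
      ∑ j, (p j).1 0 * t ^ (j : ℕ) := h1
    rw [h2] at h3
    linear_combination -h3
  have hp0 := eq_zero_of_sum_eq_pow_mul hQu haxis
  have hp0' (j) : (p j).1 0 = 0 := congrFun hp0 j
  have hQ0 : Q.1 0 ≠ 0 := by
    intro hQ0
    have h1 : ∀ᶠ t in 𝓝[≠] (0 : ℂ), 1 - Q.1 (Fin.cons t 0) * u t = 0 := by
      filter_upwards [nhdsWithin_le_nhds haxis, self_mem_nhdsWithin] with t ht ht0
      simp only [hp0', zero_mul, Finset.sum_const_zero] at ht
      exact (mul_eq_zero.1 ht.symm).resolve_left (pow_ne_zero _ ht0)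
    have h2 := tendsto_nhds_unique ((hQu.tendsto.mono_left nhdsWithin_le_nhds).congr' h1)
      tendsto_const_nhds
    rw [show (Fin.cons 0 0 : Cn (n + 1)) = 0 from cons_zero_zero, hQ0] at h2
    simp at h2
  have hP : ∀ᶠ z in 𝓝 0, (monicPoly p).1 z = Q.1 z * g.1 z := by
    filter_upwards [hp] with z hz
    have hz' : evalAt z (coord 0 ^ k) = _ := hz
    have : evalAt z (monicPoly p) = Q.1 z * g.1 z := by
      rw [monicPoly, map_sub, hz', map_sum, add_sub_assoc, add_eq_left, sub_eq_zero]
      simp only [map_mul, map_pow]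
      rfl
    exact this
  refine ⟨k, p, hp0', ⟨Q, hP⟩, fun b => ?_⟩
  obtain ⟨Qb, r, hr⟩ := hdiv' b
  refine ⟨Qb * ⟨fun z => (Q.1 z)⁻¹, Q.2.inv hQ0⟩, r, ?_⟩
  filter_upwards [hr, hP, Q.2.continuousAt.eventually_ne hQ0] with z hz hPz hQz
  have hz' : evalAt z b = _ := hz
  have hP' : evalAt z (monicPoly p) = Q.1 z * g.1 z := hPz
  simp only [← evalAt_apply, map_add, map_mul, map_sum, map_pow]
  rw [hz', hP']
  change _ = Qb.1 z * (Q.1 z)⁻¹ * _ + ∑ j, (r j).1 (Fin.tail z) * z 0 ^ (j : ℕ)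
  field_simp

theorem exists_frequently_smul_ne_zero {f : An (n + 1)} (hf : ¬ f.1 =ᶠ[𝓝 0] 0) :
    ∃ v : Cn (n + 1), v ≠ 0 ∧ ∃ᶠ t in 𝓝 (0 : ℂ), f.1 (t • v) ≠ 0 := by
  obtain ⟨r, hr, hfr⟩ := Metric.eventually_nhds_iff_ball.1 f.2.eventually_analyticAt
  obtain ⟨v, hv0, hvr, hfv⟩ : ∃ v : Cn (n + 1), v ≠ 0 ∧ v ∈ Metric.ball 0 r ∧ f.1 v ≠ 0 := by
    by_contra! hcon
    refine hf ((f.2.continuousAt.eventuallyEq_nhds_iff_eventuallyEq_nhdsNE continuousAt_const).1 ?_)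
    filter_upwards [self_mem_nhdsWithin, nhdsWithin_le_nhds (Metric.ball_mem_nhds 0 hr)] with v h1 h2
    exact hcon v h1 h2
  refine ⟨v, hv0, fun hcon => hfv ?_⟩
  let U : Set ℂ := (fun t : ℂ => t • v) ⁻¹' Metric.ball 0 r
  have hU : IsPreconnected U := by
    have h : Convex ℝ U := (convex_ball _ _).is_linear_preimage
      (((LinearMap.id : ℂ →ₗ[ℂ] ℂ).smulRight v).restrictScalars ℝ).isLinear
    exact h.isPreconnected
  have hfa : AnalyticOnNhd ℂ (fun t : ℂ => f.1 (t • v)) U := fun t ht =>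
    AnalyticAt.fun_comp (f := fun t : ℂ => t • v) (hfr _ ht) (analyticAt_id.smul analyticAt_const)
  have h := hfa.eqOn_zero_of_preconnected_of_eventuallyEq_zero hU (z₀ := 0)
    (by simpa [U] using hr) (by filter_upwards [hcon] with t ht using not_not.1 ht)
  simpa using h (x := 1) (by simpa [U] using hvr)

theorem exists_coordinates {F : Type} [Field F] [Algebra ℂ F] {φ : An (n + 1) →ₐ[ℂ] F}
    (hφ : IsGermHom φ) {f : An (n + 1)} (hf : φ f = 0) (hf0 : ¬ f.1 =ᶠ[𝓝 0] 0) :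
    ∃ (L : Cn (n + 1) ≃L[ℂ] Cn (n + 1)) (k : ℕ) (p : Fin k → An n), (∀ j, (p j).1 0 = 0) ∧
      φ (pullL L (monicPoly p)) = 0 ∧
      ∀ b : An (n + 1), ∃ (Q : An (n + 1)) (r : Fin k → An n), b.1 =ᶠ[𝓝 0]
        (Q * monicPoly p + ∑ j, pullL (tailL n) (r j) * coord 0 ^ (j : ℕ)).1 := by
  obtain ⟨v, hv, hfv⟩ := exists_frequently_smul_ne_zero hf0
  have he : (Fin.cons 1 0 : Cn (n + 1)) ≠ 0 := fun h => by simpa using congrFun h 0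
  obtain ⟨L, hL⟩ := SeparatingDual.exists_continuousLinearEquiv_apply_eq (R := ℂ) hv he
  let g : An (n + 1) := pullL (L.symm : Cn (n + 1) →L[ℂ] Cn (n + 1)) f
  have hg : pullL (L : Cn (n + 1) →L[ℂ] Cn (n + 1)) g = f := by
    ext z
    simp [g]
  obtain ⟨k, p, hp, ⟨Q, hQ⟩, hdiv⟩ := exists_monicPoly (g := g) <| hfv.mono fun t ht => by
    have : (Fin.cons t 0 : Cn (n + 1)) = t • L v := by
      rw [hL]
      funext i
      refine Fin.cases ?_ (fun i => ?_) i <;> simp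
    rw [pullL_apply, this]
    simpa using ht
  refine ⟨L, k, p, hp, ?_, hdiv⟩
  have := hφ.comp_pullL (L : Cn (n + 1) →L[ℂ] Cn (n + 1)) _ _ hQ
  rw [AlgHom.comp_apply, AlgHom.comp_apply, map_mul, hg, map_mul, hf, mul_zero] at this
  exact this

end An

namespace An

open Polynomial

variable {n k : ℕ}

/-- The polynomial of degree less than `k` with given coefficients. -/
def lowPoly {R : Type*} [CommRing R] (r : Fin k → R) : R[X] := ∑ j, C (r j) * X ^ (j : ℕ)

theorem degree_lowPoly_lt {R : Type*} [CommRing R] (r : Fin k → R) : (lowPoly r).degree < k := by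
  refine (degree_sum_le _ _).trans_lt ((Finset.sup_lt_iff (WithBot.bot_lt_coe k)).2 fun j _ => ?_)
  exact (degree_C_mul_X_pow_le _ _).trans_lt (Nat.cast_lt.2 j.2)

theorem natDegree_lowPoly_le {R : Type*} [CommRing R] (r : Fin k → R) :
    (lowPoly r).natDegree ≤ k :=
  natDegree_le_of_degree_le (degree_lowPoly_lt r).le

theorem map_lowPoly {R S : Type*} [CommRing R] [CommRing S] (f : R →+* S) (r : Fin k → R) :
    (lowPoly r).map f = lowPoly fun j => f (r j) := by
  simp [lowPoly, Polynomial.map_sum]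

theorem eval_lowPoly {R : Type*} [CommRing R] (r : Fin k → R) (t : R) :
    (lowPoly r).eval t = ∑ j, r j * t ^ (j : ℕ) := by
  simp [lowPoly, eval_finsetSum]

theorem coeff_lowPoly {R : Type*} [CommRing R] (r : Fin k → R) (j : Fin k) :
    (lowPoly r).coeff j = r j := by
  simp [lowPoly, finsetSum_coeff, coeff_X_pow, Fin.val_inj]

theorem monic_X_pow_sub_lowPoly {R : Type*} [CommRing R] (r : Fin k → R) :
    (X ^ k - lowPoly r).Monic :=
  monic_X_pow_sub (degree_lowPoly_lt r)

theorem natDegree_X_pow_sub_lowPoly {R : Type*} [CommRing R] [Nontrivial R] (r : Fin k → R) :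
    (X ^ k - lowPoly r).natDegree = k := by
  refine natDegree_eq_of_degree_eq_some ?_
  rw [degree_sub_eq_left_of_degree_lt] <;> rw [degree_X_pow]
  exact degree_lowPoly_lt r

theorem norm_root_lt {p : Fin k → ℂ} {ε : ℝ} (hε : 0 < ε) (hε1 : ε ≤ 1)
    (hp : ∑ j, ‖p j‖ < ε ^ k) {t : ℂ} (ht : t ^ k = ∑ j, p j * t ^ (j : ℕ)) : ‖t‖ < ε := by
  have h1 : ‖t‖ ^ k ≤ ∑ j, ‖p j‖ * ‖t‖ ^ (j : ℕ) := by
    rw [← norm_pow, ht]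
    refine (norm_sum_le _ _).trans_eq ?_
    simp
  rcases le_or_gt 1 ‖t‖ with h | h
  · have h2 : ∑ j, ‖p j‖ * ‖t‖ ^ (j : ℕ) ≤ (∑ j, ‖p j‖) * ‖t‖ ^ k := by
      rw [Finset.sum_mul]
      gcongr with j
      exact j.2.le
    have h3 : 0 < ‖t‖ ^ k := by positivity
    have h4 := pow_le_one₀ (n := k) hε.le hε1
    nlinarith
  · have h2 : ∑ j, ‖p j‖ * ‖t‖ ^ (j : ℕ) ≤ ∑ j, ‖p j‖ :=
      Finset.sum_le_sum fun j _ =>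
        mul_le_of_le_one_right (norm_nonneg _) (pow_le_one₀ (norm_nonneg _) h.le)
    exact lt_of_pow_lt_pow_left₀ k hε.le (by linarith)

theorem eq_zero_of_lowPoly_eval_eq_zero {m : ℕ} {c : Fin m → ℂ} {A : Finset ℕ} (hA : m < A.card)
    (h : ∀ l ∈ A, ∑ i : Fin m, (l : ℂ) ^ (i : ℕ) * c i = 0) (i : Fin m) : c i = 0 := by
  classical
  have h0 : lowPoly c = 0 := by
    refine eq_zero_of_natDegree_lt_card_of_eval_eq_zero' (lowPoly c)
      (A.image (Nat.cast : ℕ → ℂ)) (fun t ht => ?_) ?_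
    · obtain ⟨l, hl, rfl⟩ := Finset.mem_image.1 ht
      rw [eval_lowPoly, ← h l hl]
      exact Finset.sum_congr rfl fun _ _ => mul_comm _ _
    · rw [Finset.card_image_of_injective _ Nat.cast_injective]
      exact (natDegree_lowPoly_le c).trans_lt hA
  rw [← coeff_lowPoly c i, h0, coeff_zero]

section Remainder

variable {F : Type} [Field F] [Algebra ℂ F]

theorem IsGermHom.eq_zero_of_coord {φ : An n →ₐ[ℂ] F} (hφ : IsGermHom φ)
    (hz : ∀ i, φ (coord i) = 0) {f : An n} (hf : f.1 0 = 0) : φ f = 0 := by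
  obtain ⟨h, hh⟩ := exists_eq_add_sum f
  rw [hφ _ _ hh, map_add, hf, map_zero, map_zero, zero_add, map_sum]
  exact Finset.sum_eq_zero fun i _ => by rw [map_mul, hz, zero_mul]

/-- A remainder of Weierstrass division, as a function. -/
def remainder (r : Fin k → An n) : An (n + 1) := ∑ j, pullL (tailL n) (r j) * coord 0 ^ (j : ℕ)

theorem map_remainder {R : Type*} [CommRing R] [Algebra ℂ R] (φ : An (n + 1) →ₐ[ℂ] R)
    (r : Fin k → An n) : φ (remainder r) =
      (lowPoly r).eval₂ (φ.comp (pullL (tailL n)) : An n →+* R) (φ (coord 0)) := by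
  simp [remainder, lowPoly, eval₂_finsetSum]

theorem monicPoly_eq (p : Fin k → An n) : monicPoly p = coord 0 ^ k - remainder p := rfl

theorem map_monicPoly {R : Type*} [CommRing R] [Algebra ℂ R] (φ : An (n + 1) →ₐ[ℂ] R)
    (p : Fin k → An n) : φ (monicPoly p) =
      (X ^ k - lowPoly p).eval₂ (φ.comp (pullL (tailL n)) : An n →+* R) (φ (coord 0)) := by
  simp [monicPoly_eq, map_remainder]

theorem evalAt_remainder (r : Fin k → An n) (t : ℂ) (y : Cn n) :
    evalAt (Fin.cons t y : Cn (n + 1)) (remainder r) =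
      (lowPoly fun j => evalAt y (r j)).eval t := by
  rw [remainder, map_sum, eval_lowPoly]
  simp

theorem evalAt_monicPoly (p : Fin k → An n) (t : ℂ) (y : Cn n) :
    evalAt (Fin.cons t y : Cn (n + 1)) (monicPoly p) =
      (X ^ k - lowPoly fun j => evalAt y (p j)).eval t := by
  rw [monicPoly_eq, map_sub, evalAt_remainder]
  simp

theorem map_resultant_eq_zero {φ : An (n + 1) →ₐ[ℂ] F} (hk : k ≠ 0) {p r : Fin k → An n}
    (hp : φ (monicPoly p) = 0) (hr : φ (remainder r) = 0) :
    φ (pullL (tailL n) ((X ^ k - lowPoly p).resultant (lowPoly r) k k)) = 0 := by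
  obtain ⟨a, b, -, -, h⟩ := exists_mul_add_mul_eq_C_resultant (m := k) (n := k) (X ^ k - lowPoly p)
    (lowPoly r) (natDegree_X_pow_sub_lowPoly p).le (natDegree_lowPoly_le r) (Or.inl hk)
  have := congrArg (eval₂ (φ.comp (pullL (tailL n)) : An n →+* F) (φ (coord 0))) h
  rw [eval₂_add, eval₂_mul, eval₂_mul, ← map_monicPoly, ← map_remainder, hp, hr, zero_mul,
    zero_mul, add_zero, eval₂_C] at this
  exact this.symm

theorem exists_root_of_resultant_eq_zero {p r : Fin k → An n} {y : Cn n}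
    (h : evalAt y ((X ^ k - lowPoly p).resultant (lowPoly r) k k) = 0) :
    ∃ t : ℂ, evalAt (Fin.cons t y : Cn (n + 1)) (monicPoly p) = 0 ∧
      evalAt (Fin.cons t y : Cn (n + 1)) (remainder r) = 0 := by
  have h1 : (X ^ k - lowPoly fun j => evalAt y (p j)).resultant
      (lowPoly fun j => evalAt y (r j)) k k = 0 := by
    rw [← h, ← AlgHom.coe_toRingHom, ← resultant_map_map, Polynomial.map_sub, map_lowPoly,
      map_lowPoly, Polynomial.map_pow, map_X]
  have h2 := resultant_eq_prod_eval (X ^ k - lowPoly fun j => evalAt y (p j))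
    (lowPoly fun j => evalAt y (r j)) k (natDegree_lowPoly_le _) (IsAlgClosed.splits _)
  rw [natDegree_X_pow_sub_lowPoly, h1, (monic_X_pow_sub_lowPoly _).leadingCoeff, one_pow, one_mul,
    eq_comm, Multiset.prod_eq_zero_iff, Multiset.mem_map] at h2
  obtain ⟨t, ht, ht'⟩ := h2
  refine ⟨t, ?_, ?_⟩
  · rw [evalAt_monicPoly]
    exact (mem_roots'.1 ht).2
  · rw [evalAt_remainder, ht']

end Remainder

end An

namespace An

variable {n k : ℕ} {F : Type} [Field F] [Algebra ℂ F]

theorem exists_coord_tail_ne_zero {φ : An (n + 1) →ₐ[ℂ] F} (hφ : IsGermHom φ)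
    {p : Fin k → An n} (hp0 : ∀ j, (p j).1 0 = 0) (hp : φ (monicPoly p) = 0)
    (hz : ∃ i, φ (coord i) ≠ 0) : ∃ j, φ (pullL (tailL n) (coord j)) ≠ 0 := by
  by_contra! hcon
  have hφ' := hφ.comp_pullL (tailL n)
  have h1 (j : Fin k) : φ (pullL (tailL n) (p j)) = 0 :=
    hφ'.eq_zero_of_coord (fun i => hcon i) (hp0 j)
  have h2 : φ (coord 0) = 0 := by
    rw [monicPoly, map_sub, map_sum, Finset.sum_eq_zero, sub_zero, map_pow] at hp
    · exact eq_zero_of_pow_eq_zero hp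
    · intro j _
      rw [map_mul, h1, zero_mul]
  obtain ⟨i, hi⟩ := hz
  refine hi ?_
  refine Fin.cases h2 (fun j => hcon j) i

theorem exists_coord_pullL_ne_zero {φ : An n →ₐ[ℂ] F} (hφ : IsGermHom φ) (L : Cn n ≃L[ℂ] Cn n)
    (hz : ∃ i, φ (coord i) ≠ 0) :
    ∃ j, φ (pullL (L : Cn n →L[ℂ] Cn n) (coord j)) ≠ 0 := by
  by_contra! hcon
  obtain ⟨i, hi⟩ := hz
  refine hi ?_
  have h := (hφ.comp_pullL (L : Cn n →L[ℂ] Cn n)).eq_zero_of_coord hcon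
    (f := pullL (L.symm : Cn n →L[ℂ] Cn n) (coord i)) (by simp)
  rw [← h, AlgHom.comp_apply]
  congr 1
  ext z
  simp

/-- The inductive step of the Nullstellensatz, in Weierstrass coordinates. -/
theorem frequently_zero_step
    (ih : ∀ {φ : An n →ₐ[ℂ] F}, IsGermHom φ → (∃ i, φ (coord i) ≠ 0) →
      ∀ (N : ℕ) (s : Fin N → An n), (∀ i, φ (s i) = 0) →
        ∃ᶠ z in 𝓝[≠] (0 : Cn n), ∀ i, (s i).1 z = 0)
    {φ : An (n + 1) →ₐ[ℂ] F} (hφ : IsGermHom φ) {p : Fin k → An n} (hp0 : ∀ j, (p j).1 0 = 0)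
    (hp : φ (monicPoly p) = 0)
    (hdiv : ∀ b : An (n + 1), ∃ (Q : An (n + 1)) (r : Fin k → An n), b.1 =ᶠ[𝓝 0]
      (Q * monicPoly p + ∑ j, pullL (tailL n) (r j) * coord 0 ^ (j : ℕ)).1)
    (hz : ∃ i, φ (coord i) ≠ 0) (m : ℕ) (s : Fin m → An (n + 1)) (hs : ∀ i, φ (s i) = 0) :
    ∃ᶠ z in 𝓝[≠] (0 : Cn (n + 1)), ∀ i, (s i).1 z = 0 := by
  have hk : k ≠ 0 := by
    rintro rfl
    simp [monicPoly] at hp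
  let N := k * m + 1
  let S : ℕ → An (n + 1) := fun l => ∑ i : Fin m, algebraMap ℂ _ ((l : ℂ) ^ (i : ℕ)) * s i
  choose Q r hQr using fun l => hdiv (S l)
  have hSz (l : ℕ) : φ (S l) = 0 := by
    rw [map_sum]
    exact Finset.sum_eq_zero fun i _ => by rw [map_mul, hs, mul_zero]
  have hr (l : ℕ) : φ (remainder (r l)) = 0 := by
    have := hφ _ _ (hQr l)
    rwa [hSz, map_add, map_mul, hp, mul_zero, zero_add, eq_comm] at this
  have hfreq := ih (hφ.comp_pullL (tailL n)) (exists_coord_tail_ne_zero hφ hp0 hp hz) N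
    (fun l => (Polynomial.X ^ k - lowPoly p).resultant (lowPoly (r l)) k k)
    fun l => map_resultant_eq_zero hk hp (hr l)
  rw [frequently_nhdsWithin_iff, Filter.frequently_iff]
  intro U hU
  have hU' : ∀ᶠ z in 𝓝 (0 : Cn (n + 1)), z ∈ U ∧ ∀ l : Fin N, (S l).1 z =
      (Q l * monicPoly p + ∑ j, pullL (tailL n) (r l j) * coord 0 ^ (j : ℕ)).1 z := by
    filter_upwards [hU, eventually_all.2 fun l : Fin N => hQr l] with z h1 h2 using ⟨h1, h2⟩
  obtain ⟨ε', hε', hball'⟩ := Metric.eventually_nhds_iff_ball.1 hU'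
  set ε := min ε' 1 with hεdef
  have hε : 0 < ε := lt_min hε' one_pos
  have hball : ∀ z ∈ Metric.ball (0 : Cn (n + 1)) ε, _ := fun z hz =>
    hball' z (Metric.ball_subset_ball (min_le_left _ _) hz)
  have hpsmall : ∀ᶠ y in 𝓝[≠] (0 : Cn n), ∑ j, ‖(p j).1 y‖ < ε ^ k := by
    have h : Tendsto (fun y => ∑ j, ‖(p j).1 y‖) (𝓝 0) (𝓝 (∑ j, ‖(p j).1 0‖)) :=
      tendsto_finsetSum _ fun j _ => (p j).2.continuousAt.norm
    simp only [hp0, norm_zero, Finset.sum_const_zero] at h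
    exact nhdsWithin_le_nhds (h.eventually_lt_const (by positivity))
  have hysmall : ∀ᶠ y in 𝓝[≠] (0 : Cn n), ‖y‖ < ε := by
    filter_upwards [nhdsWithin_le_nhds (Metric.ball_mem_nhds 0 hε)] with y hy
    exact mem_ball_zero_iff.1 hy
  obtain ⟨y, hres, hpy, hyε, hy0⟩ := (hfreq.and_eventually
    (hpsmall.and (hysmall.and self_mem_nhdsWithin))).exists
  choose t htP htR using fun l : Fin N => exists_root_of_resultant_eq_zero (hres l)
  have htball (l : Fin N) : (Fin.cons (t l) y : Cn (n + 1)) ∈ Metric.ball 0 ε := by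
    have h1 : ‖t l‖ < ε := by
      refine norm_root_lt hε (min_le_right _ _) hpy ?_
      have := htP l
      rw [evalAt_monicPoly, Polynomial.eval_sub, eval_lowPoly, Polynomial.eval_pow,
        Polynomial.eval_X, sub_eq_zero] at this
      exact this
    rw [mem_ball_zero_iff, pi_norm_lt_iff hε]
    exact fun i => Fin.cases h1 (fun i => (norm_le_pi_norm y i).trans_lt hyε) i
  have hSl (l : Fin N) : evalAt (Fin.cons (t l) y : Cn (n + 1)) (S l) = 0 := by
    have h1 := (hball _ (htball l)).2 l
    have h2 : evalAt (Fin.cons (t l) y : Cn (n + 1)) (S l) = evalAt (Fin.cons (t l) y : Cn (n + 1))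
      (Q l * monicPoly p + remainder (r l)) := h1
    rw [h2, map_add, map_mul, htP, htR, mul_zero, add_zero]
  classical
  let roots := (Polynomial.X ^ k - lowPoly fun j => evalAt y (p j)).roots.toFinset
  have hroots : roots.card ≤ k := by
    refine (Multiset.toFinset_card_le _).trans ((Polynomial.card_roots' _).trans ?_)
    rw [natDegree_X_pow_sub_lowPoly]
  have htroots (l : Fin N) : t l ∈ roots := by
    rw [Multiset.mem_toFinset, Polynomial.mem_roots (monic_X_pow_sub_lowPoly _).ne_zero,
      Polynomial.IsRoot.def, ← evalAt_monicPoly]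
    exact htP l
  obtain ⟨t₀, -, ht₀⟩ := Finset.exists_lt_card_fiber_of_mul_lt_card_of_maps_to
    (s := Finset.univ) (t := roots) (f := t) (n := m) (fun l _ => htroots l) (by
      rw [Finset.card_univ, Fintype.card_fin]
      exact (Nat.mul_le_mul_right m hroots).trans_lt (Nat.lt_succ_self _))
  have hzero (i : Fin m) : evalAt (Fin.cons t₀ y : Cn (n + 1)) (s i) = 0 := by
    refine eq_zero_of_lowPoly_eval_eq_zero (c := fun i => evalAt (Fin.cons t₀ y : Cn (n + 1)) (s i))
      (A := (Finset.univ.filter fun l => t l = t₀).image Fin.val) ?_ ?_ i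
    · rwa [Finset.card_image_of_injective _ Fin.val_injective]
    · intro l hl
      obtain ⟨l', hl', rfl⟩ := Finset.mem_image.1 hl
      have h := hSl l'
      rw [(Finset.mem_filter.1 hl').2, map_sum] at h
      simpa only [map_mul, AlgHom.commutes, Algebra.algebraMap_self, RingHom.id_apply] using h
  obtain ⟨l₀, hl₀⟩ := Finset.card_pos.1 ((Nat.zero_le m).trans_lt ht₀)
  have hl₀' := (Finset.mem_filter.1 hl₀).2
  refine ⟨Fin.cons t₀ y, ?_, hzero, fun h => hy0 ?_⟩
  · rw [← hl₀']
    exact (hball _ (htball l₀)).1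
  · rw [← Fin.tail_cons (α := fun _ => ℂ) t₀ y, h]
    rfl

theorem frequently_zero_fin (n : ℕ) : ∀ {φ : An n →ₐ[ℂ] F}, IsGermHom φ → (∃ i, φ (coord i) ≠ 0) →
    ∀ (N : ℕ) (s : Fin N → An n), (∀ i, φ (s i) = 0) →
      ∃ᶠ z in 𝓝[≠] (0 : Cn n), ∀ i, (s i).1 z = 0 := by
  induction n with
  | zero =>
    rintro φ - ⟨i, -⟩
    exact i.elim0
  | succ n ih =>
    intro φ hφ hz N s hs
    by_cases hinj : ∀ f, φ f = 0 → f.1 =ᶠ[𝓝 0] 0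
    · have : (𝓝[≠] (0 : Cn (n + 1))).NeBot := Module.punctured_nhds_neBot ℂ (Cn (n + 1)) 0
      exact Eventually.frequently (eventually_all.2 fun i =>
        nhdsWithin_le_nhds (hinj _ (hs i)))
    push Not at hinj
    obtain ⟨f, hf, hf0⟩ := hinj
    obtain ⟨L, k, p, hp0, hp, hdiv⟩ := exists_coordinates hφ hf hf0
    have h := frequently_zero_step ih (hφ.comp_pullL (L : Cn (n + 1) →L[ℂ] Cn (n + 1))) hp0 hp hdiv
      (exists_coord_pullL_ne_zero hφ L hz) N
      (fun i => pullL (L.symm : Cn (n + 1) →L[ℂ] Cn (n + 1)) (s i)) fun i => by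
        rw [← hs i, AlgHom.comp_apply]
        congr 1
        ext z
        simp
    have hL : Tendsto L.symm (𝓝[≠] 0) (𝓝[≠] 0) := by
      refine tendsto_nhdsWithin_iff.2 ⟨(tendsto_zero
        (L.symm : Cn (n + 1) →L[ℂ] Cn (n + 1))).mono_left nhdsWithin_le_nhds, ?_⟩
      filter_upwards [self_mem_nhdsWithin] with z hz
      simpa using hz
    exact hL.frequently h

/-- **The Rückert Nullstellensatz**: if a germ homomorphism to a field does not vanish at all the
coordinates, finitely many functions in its kernel have common zeros accumulating at `0`. -/
theorem frequently_zero {φ : An n →ₐ[ℂ] F} (hφ : IsGermHom φ) (hz : ∃ i, φ (coord i) ≠ 0)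
    {ι : Type} [Finite ι] (s : ι → An n) (hs : ∀ i, φ (s i) = 0) :
    ∃ᶠ z in 𝓝[≠] (0 : Cn n), ∀ i, (s i).1 z = 0 := by
  obtain ⟨N, ⟨e⟩⟩ := Finite.exists_equiv_fin ι
  refine (frequently_zero_fin n hφ hz N (fun i => s (e.symm i)) fun i => hs _).mono ?_
  intro z hz i
  simpa using hz (e i)

end An

/-- A homomorphism to a field whose image generates the field. -/
def Generates {A F : Type*} [CommRing A] [Field F] (φ : A →+* F) : Prop :=
  ∀ x : F, ∃ a b, φ b ≠ 0 ∧ x * φ b = φ a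

theorem Generates.exists_derivation {A F : Type*} [CommRing A] [Field F] {φ : A →+* F}
    (hφ : Generates φ) (δ : A → F) (hadd : ∀ a b, δ (a + b) = δ a + δ b)
    (hmul : ∀ a b, δ (a * b) = φ a * δ b + φ b * δ a) (hker : ∀ a, φ a = 0 → δ a = 0) :
    ∃ D : Derivation ℤ F F, ∀ a, D (φ a) = δ a := by
  choose num den hden hnum using hφ
  have h0 : δ 0 = 0 := hker 0 (map_zero φ)
  have hneg (a : A) : δ (-a) = -δ a := by
    rw [eq_neg_iff_add_eq_zero, ← hadd, neg_add_cancel, h0]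
  have h1 : δ 1 = 0 := by simpa using hmul 1 1
  have hcongr (a b : A) (hab : φ a = φ b) : δ a = δ b := by
    have := hker (a + -b) (by simp [hab])
    rw [hadd, hneg] at this
    linear_combination this
  have key (x : F) (a b : A) (hb : φ b ≠ 0) (hx : x * φ b = φ a) :
      (δ (num x) - x * δ (den x)) / φ (den x) = (δ a - x * δ b) / φ b := by
    have h := hcongr (a * den x) (num x * b) (by
      rw [map_mul, map_mul, ← hx, ← hnum]
      ring)
    rw [hmul, hmul, ← hx, ← hnum] at h
    rw [div_eq_div_iff (hden x) hb]
    linear_combination -h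
  let D : F →+ F :=
    { toFun := fun x => (δ (num x) - x * δ (den x)) / φ (den x)
      map_zero' := by rw [key 0 0 1 (by simp) (by simp), h0]; simp
      map_add' := fun x y => by
        have hx := hden x
        have hy := hden y
        rw [key (x + y) (num x * den y + num y * den x) (den x * den y)
          (by simp [hx, hy]) (by simp only [map_add, map_mul, ← hnum]; ring), hadd, hmul, hmul,
          hmul, map_mul, ← hnum, ← hnum]
        field_simp
        ring }
  refine ⟨Derivation.mk' D.toIntLinearMap fun x y => ?_, fun a => ?_⟩
  · change (δ (num (x * y)) - x * y * δ (den (x * y))) / φ (den (x * y)) =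
      x * ((δ (num y) - y * δ (den y)) / φ (den y)) + y * ((δ (num x) - x * δ (den x)) / φ (den x))
    have hx := hden x
    have hy := hden y
    rw [key (x * y) (num x * num y) (den x * den y)
      (by simp [hx, hy]) (by simp only [map_mul, ← hnum]; ring), hmul, hmul, map_mul, ← hnum, ← hnum]
    field_simp
    ring
  · change (δ (num (φ a)) - φ a * δ (den (φ a))) / φ (den (φ a)) = _
    rw [key (φ a) a 1 (by simp) (by simp), h1]
    simp

namespace An

variable {n : ℕ} {F : Type} [Field F] [Algebra ℂ F]

theorem exists_eq_smul {a b : An n} (hb : ¬ b.1 =ᶠ[𝓝 0] 0)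
    (hab : ∀ i, (a * partialDeriv i b).1 =ᶠ[𝓝 0] (b * partialDeriv i a).1) :
    ∃ c : ℂ, a.1 =ᶠ[𝓝 0] (c • b).1 := by
  have hev : ∀ᶠ z in 𝓝 (0 : Cn n), AnalyticAt ℂ a.1 z ∧ AnalyticAt ℂ b.1 z ∧
      ∀ i, (a * partialDeriv i b).1 z = (b * partialDeriv i a).1 z := by
    filter_upwards [a.2.eventually_analyticAt, b.2.eventually_analyticAt, eventually_all.2 hab]
      with z h1 h2 h3 using ⟨h1, h2, h3⟩
  obtain ⟨ε, hε, hB⟩ := Metric.eventually_nhds_iff_ball.1 hev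
  obtain ⟨z₀, hbz, hz₀⟩ := ((not_eventually.1 hb).and_eventually
    (Metric.ball_mem_nhds (0 : Cn n) hε)).exists
  have hbz : b.1 z₀ ≠ 0 := hbz
  have hev₀ : ∀ᶠ z in 𝓝 z₀, b.1 z ≠ 0 ∧ z ∈ Metric.ball (0 : Cn n) ε :=
    ((hB z₀ hz₀).2.1.continuousAt.eventually_ne hbz).and (Metric.isOpen_ball.mem_nhds hz₀)
  obtain ⟨δ, hδ, hB₀⟩ := Metric.eventually_nhds_iff_ball.1 hev₀
  have hd (z : Cn n) (hz : z ∈ Metric.ball z₀ δ) :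
      HasFDerivAt (fun z => a.1 z / b.1 z) (0 : Cn n →L[ℂ] ℂ) z := by
    obtain ⟨hbz, hz⟩ := hB₀ z hz
    obtain ⟨ha, hb, hab⟩ := hB z hz
    have hq : DifferentiableAt ℂ (fun z => a.1 z / b.1 z) z := (ha.fun_div hb hbz).differentiableAt
    convert hq.hasFDerivAt using 1
    have hmul : (fun z => a.1 z / b.1 z) * b.1 =ᶠ[𝓝 z] a.1 := by
      filter_upwards [hb.continuousAt.eventually_ne hbz] with y hy using div_mul_cancel₀ _ hy
    have hfd := hmul.fderiv_eq (𝕜 := ℂ)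
    rw [fderiv_mul hq hb.differentiableAt] at hfd
    ext v
    have hsum : ∑ i, v i * (a.1 z * pder b.1 i z) = ∑ i, v i * (b.1 z * pder a.1 i z) :=
      Finset.sum_congr rfl fun i _ => congrArg (v i * ·) (hab i)
    have hv : a.1 z * fderiv ℂ b.1 z v = b.1 z * fderiv ℂ a.1 z v := by
      rw [fderiv_eq_sum_pder, fderiv_eq_sum_pder, Finset.mul_sum, Finset.mul_sum]
      convert hsum using 2 <;> ring
    have hfv := congrArg (fun T : Cn n →L[ℂ] ℂ => b.1 z * T v) hfd
    simp only [add_apply, smul_apply, smul_eq_mul, ← hv] at hfv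
    have : b.1 z * (a.1 z / b.1 z) = a.1 z := mul_div_cancel₀ _ hbz
    have h0 : b.1 z * (b.1 z * fderiv ℂ (fun z => a.1 z / b.1 z) z v) = 0 := by
      linear_combination hfv - fderiv ℂ b.1 z v * this
    symm
    simpa [hbz] using h0
  refine ⟨a.1 z₀ / b.1 z₀, ?_⟩
  have hc (z : Cn n) (hz : z ∈ Metric.ball z₀ δ) : a.1 z / b.1 z = a.1 z₀ / b.1 z₀ :=
    Metric.isOpen_ball.is_const_of_fderiv_eq_zero (convex_ball z₀ δ).isPreconnected
      (fun z hz => (hd z hz).differentiableAt.differentiableWithinAt)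
      (fun z hz => (hd z hz).fderiv) hz (Metric.mem_ball_self hδ)
  have han : AnalyticOnNhd ℂ (fun z => a.1 z - a.1 z₀ / b.1 z₀ * b.1 z) (Metric.ball 0 ε) :=
    fun z hz => (hB z hz).1.fun_sub (analyticAt_const.fun_mul (hB z hz).2.1)
  have hzero := han.eqOn_zero_of_preconnected_of_eventuallyEq_zero
    (convex_ball (0 : Cn n) ε).isPreconnected hz₀ (by
      filter_upwards [Metric.ball_mem_nhds z₀ hδ] with z hz
      rw [← hc z hz, div_mul_cancel₀ _ (hB₀ z hz).1, sub_self]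
      rfl)
  filter_upwards [Metric.ball_mem_nhds (0 : Cn n) hε] with z hz
  exact sub_eq_zero.1 (hzero hz)

/-- A derivation satisfying the chain rule for analytic functions of the coordinates. -/
def IsTangent (φ : An n →ₐ[ℂ] F) (D : Derivation ℤ F F) : Prop :=
  ∀ b, D (φ b) = ∑ i, D (φ (coord i)) * φ (partialDeriv i b)

theorem partialDeriv_eq_zero_of_eventuallyEq {f : An n} (hf : f.1 =ᶠ[𝓝 0] 0) (i : Fin n) :
    (partialDeriv i f).1 =ᶠ[𝓝 0] (0 : An n).1 := by
  refine (partialDeriv_congr (g := 0) hf i).trans (Eventually.of_forall fun z => ?_)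
  change fderiv ℂ (0 : Cn n → ℂ) z _ = 0
  simp

theorem IsGermHom.map_partialDeriv_add {φ : An n →ₐ[ℂ] F} (hφ : IsGermHom φ) (i : Fin n)
    (f g : An n) : φ (partialDeriv i (f + g)) = φ (partialDeriv i f) + φ (partialDeriv i g) := by
  rw [hφ _ _ (partialDeriv_add i f g), map_add]

theorem IsGermHom.map_partialDeriv_mul {φ : An n →ₐ[ℂ] F} (hφ : IsGermHom φ) (i : Fin n)
    (f g : An n) : φ (partialDeriv i (f * g)) =
      φ f * φ (partialDeriv i g) + φ g * φ (partialDeriv i f) := by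
  rw [hφ _ _ (partialDeriv_mul i f g), map_add, map_mul, map_mul]

theorem mem_range_of_injective {φ : An n →ₐ[ℂ] F} (hφ : IsGermHom φ)
    (hgen : Generates (φ : An n →+* F)) (hinj : ∀ f, φ f = 0 → f.1 =ᶠ[𝓝 0] 0) {x : F}
    (hx : ∀ D, IsTangent φ D → D x = 0) : x ∈ Set.range (algebraMap ℂ F) := by
  obtain ⟨a, b, hb, hab⟩ := hgen x
  have hb : φ b ≠ 0 := hb
  have hab : x * φ b = φ a := hab
  have hb0 : ¬ b.1 =ᶠ[𝓝 0] 0 := fun h => hb (by rw [hφ b 0 h, map_zero])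
  have key (i : Fin n) : (a * partialDeriv i b).1 =ᶠ[𝓝 0] (b * partialDeriv i a).1 := by
    obtain ⟨D, hD⟩ := hgen.exists_derivation (fun f => φ (partialDeriv i f))
      (hφ.map_partialDeriv_add i) (hφ.map_partialDeriv_mul i) fun f hf => by
        rw [hφ _ _ (partialDeriv_eq_zero_of_eventuallyEq (hinj f hf) i), map_zero]
    have hD : ∀ f, D (φ f) = φ (partialDeriv i f) := hD
    have hDt : IsTangent φ D := fun f => by
      simp only [hD, partialDeriv_coord]
      rw [Finset.sum_eq_single i (fun j _ hj => by simp [hj.symm]) (by simp)]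
      simp
    have h1 : D (x * φ b) = D (φ a) := by rw [hab]
    rw [D.leibniz, hx D hDt, hD, hD] at h1
    have h2 : φ (a * partialDeriv i b - b * partialDeriv i a) = 0 := by
      rw [map_sub, map_mul, map_mul, ← hab]
      simp only [smul_eq_mul, mul_zero, add_zero] at h1
      linear_combination φ b * h1
    filter_upwards [hinj _ h2] with z hz
    exact sub_eq_zero.1 hz
  obtain ⟨c, hc⟩ := exists_eq_smul hb0 key
  refine ⟨c, ?_⟩
  have := hφ _ _ hc
  rw [map_smul, ← hab, Algebra.smul_def] at this
  exact (mul_right_cancel₀ hb this).symm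

end An

theorem Derivation.exists_extension {E F : Type*} [Field E] [Field F] [CharZero E] [Algebra E F]
    [FiniteDimensional E F] (D₀ : Derivation ℤ E E) :
    ∃ D : Derivation ℤ F F, ∀ e, D (algebraMap E F e) = algebraMap E F (D₀ e) := by
  let : Differential E := ⟨D₀⟩
  let := Differential.differentialFiniteDimensional E F
  have := Differential.differentialAlgebraFiniteDimensional (F := E) (K := F)
  exact ⟨Differential.deriv, DifferentialAlgebra.deriv_algebraMap⟩

theorem Derivation.apply_coeff_minpoly_eq_zero {E F : Type*} [Field E] [Field F] [Algebra E F]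
    {D₀ : Derivation ℤ E E} {D : Derivation ℤ F F}
    (hD : ∀ e, D (algebraMap E F e) = algebraMap E F (D₀ e)) {x : F} (hx : IsIntegral E x)
    (hDx : D x = 0) (i : ℕ) : D₀ ((minpoly E x).coeff i) = 0 := by
  let : Differential E := ⟨D₀⟩
  let : Differential F := ⟨D⟩
  have : DifferentialAlgebra E F := ⟨hD⟩
  have h := Differential.deriv_aeval_eq x (minpoly E x)
  rw [minpoly.aeval, map_zero, show Differential.deriv x = 0 from hDx, mul_zero, add_zero] at h
  have h0 : Differential.mapCoeffs (minpoly E x) = 0 := by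
    by_contra hne
    refine (minpoly.degree_le_of_ne_zero E x hne h.symm).not_gt ?_
    have hm := minpoly.monic hx
    rw [Polynomial.degree_eq_natDegree hm.ne_zero, Polynomial.degree_lt_iff_coeff_zero]
    intro m hmm
    rw [Differential.coeff_mapCoeffs]
    rcases hmm.eq_or_lt with rfl | hlt
    · rw [hm.coeff_natDegree]
      exact D₀.map_one_eq_zero
    · rw [Polynomial.coeff_eq_zero_of_natDegree_lt hlt, map_zero]
  have := congrArg (Polynomial.coeff · i) h0
  simpa using! this

theorem mem_range_algebraMap_of_coeff_minpoly {k E F : Type*} [Field k] [IsAlgClosed k] [Field E]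
    [Field F] [Algebra k E] [Algebra k F] [Algebra E F] [IsScalarTower k E F] {x : F}
    (hx : IsIntegral E x) (h : ∀ i, (minpoly E x).coeff i ∈ Set.range (algebraMap k E)) :
    x ∈ Set.range (algebraMap k F) := by
  obtain ⟨q, hq⟩ := (Polynomial.lifts_iff_coeff_lifts (f := algebraMap k E) (minpoly E x)).2 h
  have hq' : q.map (algebraMap k E) = minpoly E x := hq
  have hq0 : q ≠ 0 := by
    rintro rfl
    exact minpoly.ne_zero hx (by simpa using hq'.symm)
  have hint : IsIntegral k x := by
    refine IsAlgebraic.isIntegral ⟨q, hq0, ?_⟩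
    rw [← Polynomial.aeval_map_algebraMap E, hq', minpoly.aeval]
  exact minpoly.mem_range_of_degree_eq_one k x
    (IsAlgClosed.degree_eq_one_of_irreducible k (minpoly.irreducible hint))

namespace An

variable {n : ℕ} {F : Type} [Field F] [Algebra ℂ F]

theorem IsGermHom.map_partialDeriv_pullL {m : ℕ} {φ : An m →ₐ[ℂ] F} (hφ : IsGermHom φ)
    (L : Cn m →L[ℂ] Cn n) (f : An n) (i : Fin m) : φ (partialDeriv i (pullL L f)) =
      ∑ j, algebraMap ℂ F (L (Pi.single i 1) j) * φ (pullL L (partialDeriv j f)) := by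
  have h : φ (partialDeriv i (pullL L f)) =
      φ (∑ j, (L (Pi.single i 1) j) • pullL L (partialDeriv j f)) := by
    refine hφ _ _ ((partialDeriv_pullL L f i).trans (Eventually.of_forall fun z => ?_))
    rw [← evalAt_apply, map_sum]
    rfl
  rw [h, map_sum]
  exact Finset.sum_congr rfl fun j _ => by rw [map_smul, Algebra.smul_def]

/-- The functions satisfying the chain rule for a given derivation. -/
def chainRuleSubring {φ : An n →ₐ[ℂ] F} (hφ : IsGermHom φ) (D : Derivation ℤ F F) :
    Subring (An n) where
  carrier := {b | D (φ b) = ∑ i, D (φ (coord i)) * φ (partialDeriv i b)}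
  mul_mem' := fun {a b} (ha : _ = _) (hb : _ = _) => by
    change D (φ (a * b)) = _
    rw [map_mul, D.leibniz, ha, hb, smul_eq_mul, smul_eq_mul, Finset.mul_sum, Finset.mul_sum,
      ← Finset.sum_add_distrib]
    refine Finset.sum_congr rfl fun i _ => ?_
    rw [hφ.map_partialDeriv_mul]
    ring
  one_mem' := by
    have (i : Fin n) : partialDeriv i (1 : An n) = 0 := by
      ext z
      change fderiv ℂ (fun _ : Cn n => (1 : ℂ)) z _ = 0
      simp
    simp [this]
  add_mem' := fun {a b} (ha : _ = _) (hb : _ = _) => by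
    change D (φ (a + b)) = _
    rw [map_add, map_add, ha, hb, ← Finset.sum_add_distrib]
    refine Finset.sum_congr rfl fun i _ => ?_
    rw [hφ.map_partialDeriv_add]
    ring
  zero_mem' := by
    have (i : Fin n) : partialDeriv i (0 : An n) = 0 := by
      ext z
      change fderiv ℂ (fun _ : Cn n => (0 : ℂ)) z _ = 0
      simp
    simp [this]
  neg_mem' := fun {a} (ha : _ = _) => by
    have (i : Fin n) : partialDeriv i (-a) = -partialDeriv i a := by
      ext z
      change fderiv ℂ (-a.1) z _ = -fderiv ℂ a.1 z _
      rw [fderiv_neg, neg_apply]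
    change D (φ (-a)) = _
    simp only [this, map_neg, ha, mul_neg, Finset.sum_neg_distrib]

theorem mem_chainRuleSubring {φ : An n →ₐ[ℂ] F} {hφ : IsGermHom φ} {D : Derivation ℤ F F}
    {b : An n} : b ∈ chainRuleSubring hφ D ↔
      D (φ b) = ∑ i, D (φ (coord i)) * φ (partialDeriv i b) := Iff.rfl

theorem coord_mem_chainRuleSubring {φ : An n →ₐ[ℂ] F} (hφ : IsGermHom φ) (D : Derivation ℤ F F)
    (j : Fin n) : coord j ∈ chainRuleSubring hφ D := by
  simp only [mem_chainRuleSubring, partialDeriv_coord]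
  rw [Finset.sum_eq_single j (fun i _ hi => by simp [hi]) (by simp)]
  simp

theorem mem_chainRuleSubring_congr {φ : An n →ₐ[ℂ] F} (hφ : IsGermHom φ) {D : Derivation ℤ F F}
    {a b : An n} (hab : a.1 =ᶠ[𝓝 0] b.1) (hb : b ∈ chainRuleSubring hφ D) :
    a ∈ chainRuleSubring hφ D := by
  simp only [mem_chainRuleSubring] at hb ⊢
  rw [hφ _ _ hab, hb]
  exact Finset.sum_congr rfl fun i _ => by rw [hφ _ _ (partialDeriv_congr hab i)]

theorem mul_mem_chainRuleSubring_of_map_eq_zero {φ : An n →ₐ[ℂ] F} (hφ : IsGermHom φ)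
    {D : Derivation ℤ F F} (a : An n) {b : An n} (hb : b ∈ chainRuleSubring hφ D) (hb0 : φ b = 0) :
    a * b ∈ chainRuleSubring hφ D := by
  rw [mem_chainRuleSubring, hb0, map_zero] at hb
  simp only [mem_chainRuleSubring, hφ.map_partialDeriv_mul, map_mul, hb0, mul_zero, map_zero,
    zero_mul, add_zero]
  simp only [mul_left_comm _ (φ a), ← Finset.mul_sum, ← hb, mul_zero]

theorem pullL_tailL_mem_chainRuleSubring {ψ : An (n + 1) →ₐ[ℂ] F} (hψ : IsGermHom ψ)
    {D : Derivation ℤ F F} {b : An n} (hb : D (ψ (pullL (tailL n) b)) =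
      ∑ i, D (ψ (pullL (tailL n) (coord i))) * ψ (pullL (tailL n) (partialDeriv i b))) :
    pullL (tailL n) b ∈ chainRuleSubring hψ D := by
  rw [mem_chainRuleSubring, hb, Fin.sum_univ_succ]
  have h0 (j : Fin n) : tailL n (Pi.single 0 1) j = 0 := by simp [Fin.tail]
  have h1 (i j : Fin n) : tailL n (Pi.single i.succ 1) j = if i = j then 1 else 0 := by
    simp [Fin.tail, Pi.single_apply, eq_comm]
  simp only [hψ.map_partialDeriv_pullL, h0, h1, map_zero, zero_mul, Finset.sum_const_zero, mul_zero,
    zero_add, apply_ite (algebraMap ℂ F), map_one, ite_mul, one_mul, Finset.sum_ite_eq,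
    Finset.mem_univ, if_true]
  rfl

theorem isTangent_of_pullL {φ : An n →ₐ[ℂ] F} (hφ : IsGermHom φ) (L : Cn n ≃L[ℂ] Cn n)
    {D : Derivation ℤ F F} (hD : IsTangent (φ.comp (pullL (L : Cn n →L[ℂ] Cn n))) D) :
    IsTangent φ D := by
  have hback (b : An n) : pullL (L : Cn n →L[ℂ] Cn n) (pullL (L.symm : Cn n →L[ℂ] Cn n) b) = b := by
    ext z
    simp
  set ψ := φ.comp (pullL (L : Cn n →L[ℂ] Cn n)) with hψ
  have hψb (b : An n) : ψ (pullL (L.symm : Cn n →L[ℂ] Cn n) b) = φ b := by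
    rw [hψ, AlgHom.comp_apply, hback]
  have key (b : An n) : D (φ b) = ∑ i, D (ψ (coord i)) *
      ∑ j, algebraMap ℂ F (L.symm (Pi.single i 1) j) * φ (partialDeriv j b) := by
    rw [← hψb, hD]
    refine Finset.sum_congr rfl fun i _ => ?_
    rw [(hφ.comp_pullL (L : Cn n →L[ℂ] Cn n)).map_partialDeriv_pullL]
    simp only [← hψ, hψb]
    rfl
  have hc (j : Fin n) : D (φ (coord j)) =
      ∑ i, D (ψ (coord i)) * algebraMap ℂ F (L.symm (Pi.single i 1) j) := by
    rw [key]
    refine Finset.sum_congr rfl fun i _ => ?_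
    congr 1
    simp only [partialDeriv_coord]
    rw [Finset.sum_eq_single j (fun i _ hi => by simp [hi]) (by simp)]
    simp
  intro b
  rw [key]
  simp only [hc, Finset.sum_mul, Finset.mul_sum]
  rw [Finset.sum_comm]
  simp only [mul_assoc]

end An

namespace An

variable {n : ℕ} {F : Type} [Field F] [Algebra ℂ F]

theorem generates_comp_pullL {φ : An n →ₐ[ℂ] F} (hgen : Generates (φ : An n →+* F))
    (L : Cn n ≃L[ℂ] Cn n) :
    Generates ((φ.comp (pullL (L : Cn n →L[ℂ] Cn n)) : An n →ₐ[ℂ] F) : An n →+* F) := fun x => by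
  obtain ⟨a, b, hb, hab⟩ := hgen x
  have hback (b : An n) : pullL (L : Cn n →L[ℂ] Cn n) (pullL (L.symm : Cn n →L[ℂ] Cn n) b) = b := by
    ext z
    simp
  refine ⟨pullL (L.symm : Cn n →L[ℂ] Cn n) a, pullL (L.symm : Cn n →L[ℂ] Cn n) b, ?_⟩
  simpa only [RingHom.coe_coe, AlgHom.comp_apply, hback] using And.intro hb hab

theorem monicPoly_mem_chainRuleSubring {k : ℕ} {ψ : An (n + 1) →ₐ[ℂ] F} (hψ : IsGermHom ψ)
    {D : Derivation ℤ F F} (hD : ∀ b, pullL (tailL n) b ∈ chainRuleSubring hψ D)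
    (p : Fin k → An n) : monicPoly p ∈ chainRuleSubring hψ D :=
  sub_mem (pow_mem (coord_mem_chainRuleSubring hψ D 0) _) <| sum_mem fun _ _ =>
    mul_mem (hD _) (pow_mem (coord_mem_chainRuleSubring hψ D 0) _)

theorem isTangent_of_monicPoly {k : ℕ} {ψ : An (n + 1) →ₐ[ℂ] F} (hψ : IsGermHom ψ)
    {p : Fin k → An n} (hp : ψ (monicPoly p) = 0)
    (hdiv : ∀ b : An (n + 1), ∃ (Q : An (n + 1)) (r : Fin k → An n), b.1 =ᶠ[𝓝 0]
      (Q * monicPoly p + ∑ j, pullL (tailL n) (r j) * coord 0 ^ (j : ℕ)).1)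
    {D : Derivation ℤ F F} (hD : ∀ b, pullL (tailL n) b ∈ chainRuleSubring hψ D) :
    IsTangent ψ D := fun b => by
  obtain ⟨Q, r, hb⟩ := hdiv b
  refine mem_chainRuleSubring_congr hψ hb (add_mem ?_ (sum_mem fun j _ =>
    mul_mem (hD _) (pow_mem (coord_mem_chainRuleSubring hψ D 0) _)))
  exact mul_mem_chainRuleSubring_of_map_eq_zero hψ Q (monicPoly_mem_chainRuleSubring hψ hD p) hp

theorem adjoin_map_coord_eq_top {k : ℕ} {ψ : An (n + 1) →ₐ[ℂ] F} (hψ : IsGermHom ψ)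
    (hgen : Generates (ψ : An (n + 1) →+* F)) {p : Fin k → An n} (hp : ψ (monicPoly p) = 0)
    (hdiv : ∀ b : An (n + 1), ∃ (Q : An (n + 1)) (r : Fin k → An n), b.1 =ᶠ[𝓝 0]
      (Q * monicPoly p + ∑ j, pullL (tailL n) (r j) * coord 0 ^ (j : ℕ)).1)
    {E : Type} [Field E] [Algebra E F] (hE : ∀ a, ψ (pullL (tailL n) a) ∈ (algebraMap E F).range) :
    IntermediateField.adjoin E {ψ (coord 0)} = ⊤ := by
  have hmem (b : An (n + 1)) : ψ b ∈ IntermediateField.adjoin E {ψ (coord 0)} := by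
    obtain ⟨Q, r, hb⟩ := hdiv b
    rw [hψ _ _ hb, map_add, map_mul, hp, mul_zero, zero_add, map_sum]
    refine sum_mem fun j _ => ?_
    rw [map_mul, map_pow]
    refine mul_mem ?_ (pow_mem (IntermediateField.mem_adjoin_simple_self E _) _)
    obtain ⟨e, he⟩ := hE (r j)
    rw [← he]
    exact IntermediateField.algebraMap_mem _ e
  rw [eq_top_iff]
  intro x _
  obtain ⟨a, b, hb, hab⟩ := hgen x
  rw [eq_div_of_mul_eq hb hab]
  exact div_mem (hmem a) (hmem b)

theorem isIntegral_map_coord {k : ℕ} {ψ : An (n + 1) →ₐ[ℂ] F} {p : Fin k → An n}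
    (hp : ψ (monicPoly p) = 0) {E : Type} [Field E] [Algebra E F]
    (hE : ∀ a, ψ (pullL (tailL n) a) ∈ (algebraMap E F).range) : IsIntegral E (ψ (coord 0)) := by
  choose e he using fun j => hE (p j)
  refine ⟨Polynomial.X ^ k - lowPoly e, monic_X_pow_sub_lowPoly e, ?_⟩
  rw [map_monicPoly] at hp
  rw [← hp]
  simp [lowPoly, Polynomial.eval₂_finsetSum, he]

theorem exists_finite_extension {k : ℕ} {ψ : An (n + 1) →ₐ[ℂ] F} (hψ : IsGermHom ψ)
    (hgen : Generates (ψ : An (n + 1) →+* F)) {p : Fin k → An n} (hp : ψ (monicPoly p) = 0)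
    (hdiv : ∀ b : An (n + 1), ∃ (Q : An (n + 1)) (r : Fin k → An n), b.1 =ᶠ[𝓝 0]
      (Q * monicPoly p + ∑ j, pullL (tailL n) (r j) * coord 0 ^ (j : ℕ)).1) :
    ∃ (E : IntermediateField ℂ F) (θ : An n →ₐ[ℂ] E), FiniteDimensional E F ∧
      IsGermHom θ ∧ Generates (θ : An n →+* E) ∧
      ∀ a, algebraMap E F (θ a) = ψ (pullL (tailL n) a) := by
  let E := IntermediateField.adjoin ℂ ((ψ.comp (pullL (tailL n))).range : Set F)
  let θ : An n →ₐ[ℂ] E := (ψ.comp (pullL (tailL n))).codRestrict E.toSubalgebra fun a =>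
    IntermediateField.subset_adjoin ℂ _ ⟨a, rfl⟩
  have hθ (a : An n) : algebraMap E F (θ a) = ψ (pullL (tailL n) a) := rfl
  have hinj := (algebraMap E F).injective
  refine ⟨E, θ, ?_, fun f g hfg => hinj ?_, fun x => ?_, hθ⟩
  · have hE (a) : ψ (pullL (tailL n) a) ∈ (algebraMap E F).range := ⟨_, hθ a⟩
    have := IntermediateField.adjoin.finiteDimensional (isIntegral_map_coord hp hE)
    rw [adjoin_map_coord_eq_top hψ hgen hp hdiv hE] at this
    exact Module.Finite.equiv IntermediateField.topEquiv.toLinearEquiv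
  · rw [hθ, hθ]
    exact hψ.comp_pullL (tailL n) f g hfg
  · obtain ⟨_, ha, _, hb, hx⟩ := IntermediateField.mem_adjoin_iff_div.1 x.2
    rw [Algebra.adjoin_eq] at ha hb
    obtain ⟨a, rfl⟩ := ha
    obtain ⟨b, rfl⟩ := hb
    by_cases hb0 : θ b = 0
    · refine ⟨0, 1, by simp, hinj ?_⟩
      have : algebraMap E F (θ b) = 0 := by rw [hb0, map_zero]
      rw [RingHom.coe_coe, map_one, mul_one, map_zero, map_zero]
      change (x : F) = 0
      rw [hx]
      exact (congrArg _ this).trans (div_zero _)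
    · refine ⟨a, b, hb0, hinj ?_⟩
      rw [map_mul]
      change (x : F) * algebraMap E F (θ b) = algebraMap E F (θ a)
      rw [hx]
      exact div_mul_cancel₀ _ (show algebraMap E F (θ b) ≠ 0 from (map_ne_zero _).2 hb0)

/-- An element of the field generated by a germ homomorphism which is killed by all tangent
derivations is constant. -/
theorem mem_range_algebraMap (n : ℕ) : ∀ {F : Type} [Field F] [Algebra ℂ F] {φ : An n →ₐ[ℂ] F},
    IsGermHom φ → Generates (φ : An n →+* F) → ∀ {x : F}, (∀ D, IsTangent φ D → D x = 0) →
    x ∈ Set.range (algebraMap ℂ F) := by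
  induction n with
  | zero =>
    intro F _ _ φ hφ hgen x _
    have hc (a : An 0) : φ a = algebraMap ℂ F (a.1 0) := by
      rw [← φ.commutes]
      refine hφ _ _ (Eventually.of_forall fun z => ?_)
      rw [Subsingleton.elim z 0]
      rfl
    obtain ⟨a, b, hb, hab⟩ := hgen x
    refine ⟨a.1 0 / b.1 0, ?_⟩
    rw [map_div₀, ← hc, ← hc]
    exact (eq_div_of_mul_eq hb hab).symm
  | succ n ih =>
    intro F _ _ φ hφ hgen x hx
    by_cases hinj : ∀ f, φ f = 0 → f.1 =ᶠ[𝓝 0] 0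
    · exact mem_range_of_injective hφ hgen hinj hx
    push Not at hinj
    obtain ⟨f, hf, hf0⟩ := hinj
    obtain ⟨L, k, p, -, hp, hdiv⟩ := exists_coordinates hφ hf hf0
    have hψ := hφ.comp_pullL (L : Cn (n + 1) →L[ℂ] Cn (n + 1))
    obtain ⟨E, θ, hfin, hθ, hθgen, hθψ⟩ :=
      exists_finite_extension hψ (generates_comp_pullL hgen L) hp hdiv
    have : CharZero E := charZero_of_injective_algebraMap (algebraMap ℂ E).injective
    have hint : IsIntegral E x := Algebra.IsIntegral.isIntegral x
    refine mem_range_algebraMap_of_coeff_minpoly hint fun i => ih hθ hθgen fun D₀ hD₀ => ?_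
    obtain ⟨D, hD⟩ := Derivation.exists_extension (F := F) D₀
    refine Derivation.apply_coeff_minpoly_eq_zero hD hint (hx D ?_) i
    refine isTangent_of_pullL hφ L (isTangent_of_monicPoly hψ hp hdiv fun b => ?_)
    refine pullL_tailL_mem_chainRuleSubring hψ ?_
    simp only [← hθψ, hD]
    rw [hD₀, map_sum]
    simp only [map_mul]

end An

theorem finite_restrictScalars_span {k R : Type*} [Field k] [CommRing R] [Algebra k R] {n m N : ℕ}
    (z : Fin n → R) (hz : ∀ f : R, ∃ (c : k) (h : Fin n → R), f = algebraMap k R c + ∑ i, z i * h i)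
    (x : Fin m → R) (hx : ∀ i j, z i ^ N * x j = 0) :
    Module.Finite k ((Ideal.span (Set.range x)).restrictScalars k) := by
  let gen (q : (Fin n → Fin N) × Fin m) : R := (∏ i, z i ^ (q.1 i : ℕ)) * x q.2
  have key (d : ℕ) : ∀ (α : Fin n → ℕ) (f : R) (j : Fin m), n * N < ∑ i, α i + d →
      f * ((∏ i, z i ^ α i) * x j) ∈ Submodule.span k (Set.range gen) := by
    have hzero (α : Fin n → ℕ) (j : Fin m) (i : Fin n) (hi : N ≤ α i) :
        (∏ i, z i ^ α i) * x j = 0 := by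
      rw [← Finset.prod_erase_mul _ _ (Finset.mem_univ i), ← Nat.sub_add_cancel hi, pow_add,
        mul_assoc, mul_assoc, hx, mul_zero, mul_zero]
    induction d with
    | zero =>
      intro α f j hα
      have : ∃ i, N ≤ α i := by
        by_contra! hlt
        have : ∑ i, α i ≤ ∑ _ : Fin n, N := Finset.sum_le_sum fun i _ => (hlt i).le
        simp only [Finset.sum_const, Finset.card_univ, Fintype.card_fin, smul_eq_mul] at this
        omega
      obtain ⟨i, hi⟩ := this
      rw [hzero α j i hi, mul_zero]
      exact zero_mem _
    | succ d ih =>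
      intro α f j hα
      by_cases hN : ∃ i, N ≤ α i
      · obtain ⟨i, hi⟩ := hN
        rw [hzero α j i hi, mul_zero]
        exact zero_mem _
      push Not at hN
      obtain ⟨c, h, hf⟩ := hz f
      rw [hf, add_mul, Finset.sum_mul]
      refine add_mem ?_ (sum_mem fun i _ => ?_)
      · rw [← Algebra.smul_def]
        exact Submodule.smul_mem _ _ (Submodule.subset_span ⟨(fun i => ⟨α i, hN i⟩, j), rfl⟩)
      · have hi : ∏ l, z l ^ (α + Pi.single i 1 : Fin n → ℕ) l = z i * ∏ l, z l ^ α l := by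
          simp only [Pi.add_apply, pow_add, Finset.prod_mul_distrib]
          rw [mul_comm, Finset.prod_eq_single i (fun l _ hl => by simp [hl]) (by simp)]
          simp
        have := ih (α + Pi.single i 1) (h i) j (by
          simp only [Pi.add_apply, Finset.sum_add_distrib, Finset.sum_pi_single', Finset.mem_univ,
            if_true]
          omega)
        rw [hi] at this
        convert this using 1
        ring
  have hfin : FiniteDimensional k (Submodule.span k (Set.range gen)) :=
    FiniteDimensional.span_of_finite k (Set.finite_range gen)
  refine Submodule.finiteDimensional_of_le (S₂ := Submodule.span k (Set.range gen)) fun y hy => ?_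
  have hy : y ∈ Ideal.span (Set.range x) := hy
  obtain ⟨c, rfl⟩ := (Ideal.mem_span_range_iff_exists_fun).1 hy
  refine sum_mem fun j _ => ?_
  simpa using key (n * N + 1) 0 (c j) j (by omega)

theorem exists_pow_mul_eq_zero {k R : Type*} [Field k] [CommRing R] [Algebra k R] {I : Ideal R}
    (hI : Module.Finite k (I.restrictScalars k)) {z x : R} (hx : x ∈ I)
    (hz : ∀ P : Polynomial k, P.coeff 0 ≠ 0 → IsUnit (Polynomial.aeval z P)) :
    ∃ a : ℕ, z ^ a * x = 0 := by
  let T : Polynomial k →ₗ[k] I.restrictScalars k :=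
    ((LinearMap.mulRight k x).comp (Polynomial.aeval z).toLinearMap).codRestrict _
      fun P => I.mul_mem_left _ hx
  have hT : ¬ Function.Injective T := fun h =>
    Polynomial.not_finite (R := k) (Module.Finite.of_injective T h)
  rw [injective_iff_map_eq_zero] at hT
  push Not at hT
  obtain ⟨P, hP, hP0⟩ := hT
  have hP : Polynomial.aeval z P * x = 0 := congrArg Subtype.val hP
  obtain ⟨Q, hQ, hQ0⟩ := Polynomial.exists_eq_pow_rootMultiplicity_mul_and_not_dvd P hP0 0
  rw [map_zero, sub_zero, Polynomial.X_dvd_iff] at hQ0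
  refine ⟨P.rootMultiplicity 0, ?_⟩
  rw [hQ, map_zero, sub_zero, map_mul, map_pow, Polynomial.aeval_X] at hP
  refine (hz Q hQ0).mul_left_cancel ?_
  rw [mul_zero, ← hP]
  ring

namespace An

variable {n : ℕ}

/-- The germ at `0` of an analytic function. -/
def toGerm (n : ℕ) : An n →ₐ[ℂ] On n where
  toFun f := ⟨(f.1 : Filter.Germ (𝓝 (0 : Cn n)) ℂ), f.1, f.2, rfl⟩
  map_one' := rfl
  map_mul' _ _ := rfl
  map_zero' := rfl
  map_add' _ _ := rfl
  commutes' _ := rfl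

theorem toGerm_eq_iff {f g : An n} : toGerm n f = toGerm n g ↔ f.1 =ᶠ[𝓝 0] g.1 :=
  Subtype.ext_iff.trans Filter.Germ.coe_eq

theorem isGermHom_toGerm : IsGermHom (toGerm n) := fun _ _ => toGerm_eq_iff.2

theorem toGerm_surjective : Function.Surjective (toGerm n) := by
  rintro ⟨_, f, hf, rfl⟩
  exact ⟨⟨f, hf⟩, rfl⟩

theorem idealOfFuns_range {ι : Type*} (u : ι → An n) :
    idealOfFuns (Set.range fun i => (u i).1) = Ideal.span (Set.range fun i => toGerm n (u i)) := by
  refine congrArg Ideal.span (Set.ext fun x => ⟨?_, ?_⟩)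
  · rintro ⟨_, ⟨i, rfl⟩, hx⟩
    exact ⟨i, Subtype.ext hx.symm⟩
  · rintro ⟨i, rfl⟩
    exact ⟨_, ⟨i, rfl⟩, rfl⟩

theorem exists_field_of_surjective {B : Type} [CommRing B] [IsDomain B] [Algebra ℂ B]
    {π : An n →ₐ[ℂ] B} (hπ : IsGermHom π) (hsurj : Function.Surjective π) :
    ∃ (F : Type) (_ : Field F) (_ : Algebra ℂ F) (φ : An n →ₐ[ℂ] F), IsGermHom φ ∧
      Generates (φ : An n →+* F) ∧ ∀ f, φ f = 0 ↔ π f = 0 := by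
  let φ : An n →ₐ[ℂ] FractionRing B := (IsScalarTower.toAlgHom ℂ B (FractionRing B)).comp π
  have hφ (f : An n) : φ f = algebraMap B (FractionRing B) (π f) := rfl
  refine ⟨FractionRing B, inferInstance, inferInstance, φ, fun f g hfg => ?_, fun x => ?_,
    fun f => ?_⟩
  · rw [hφ, hφ, hπ f g hfg]
  · obtain ⟨a, b, hb, rfl⟩ := IsFractionRing.div_surjective B x
    obtain ⟨a, rfl⟩ := hsurj a
    obtain ⟨b, rfl⟩ := hsurj b
    have hb0 : φ b ≠ 0 := IsFractionRing.to_map_ne_zero_of_mem_nonZeroDivisors hb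
    exact ⟨a, b, hb0, div_mul_cancel₀ _ hb0⟩
  · rw [hφ, FaithfulSMul.algebraMap_eq_zero_iff]

theorem exists_field {p : Ideal (On n)} (hp : p.IsPrime) :
    ∃ (F : Type) (_ : Field F) (_ : Algebra ℂ F) (φ : An n →ₐ[ℂ] F), IsGermHom φ ∧
      Generates (φ : An n →+* F) ∧ ∀ f, φ f = 0 ↔ toGerm n f ∈ p := by
  let π : An n →ₐ[ℂ] On n ⧸ p := (Ideal.Quotient.mkₐ ℂ p).comp (toGerm n)
  have hπ : IsGermHom (R := On n ⧸ p) π := fun f g hfg =>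
    congrArg (Ideal.Quotient.mk p) (isGermHom_toGerm f g hfg)
  have hsurj : Function.Surjective π := (Ideal.Quotient.mkₐ_surjective ℂ p).comp toGerm_surjective
  obtain ⟨F, h1, h2, φ, hφ, hgen, hφ0⟩ := exists_field_of_surjective (B := On n ⧸ p) hπ hsurj
  exact ⟨F, h1, h2, φ, hφ, hgen, fun f => (hφ0 f).trans Ideal.Quotient.eq_zero_iff_mem⟩

theorem coord_mem_of_isPrime {ι : Type} [Finite ι] {s : ι → An n}
    (hs : ∀ᶠ z in 𝓝 (0 : Cn n), (∀ i, (s i).1 z = 0) → z = 0) {p : Ideal (On n)} (hp : p.IsPrime)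
    (hsp : ∀ i, toGerm n (s i) ∈ p) (i : Fin n) : toGerm n (coord i) ∈ p := by
  obtain ⟨F, _, _, φ, hφ, -, hφ0⟩ := exists_field hp
  by_contra hi
  have hfreq := frequently_zero hφ ⟨i, fun h => hi ((hφ0 _).1 h)⟩ s fun j => (hφ0 _).2 (hsp j)
  obtain ⟨z, hz, h1, h0⟩ := (hfreq.and_eventually
    ((hs.filter_mono nhdsWithin_le_nhds).and self_mem_nhdsWithin)).exists
  exact h0 (h1 hz)

theorem eventually_eq_zero_of_isPrime {ι : Type*} [Finite ι] {s : ι → An n}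
    (hs : ∀ p : Ideal (On n), p.IsPrime → (∀ i, toGerm n (s i) ∈ p) →
      ∀ i, toGerm n (coord i) ∈ p) :
    ∀ᶠ z in 𝓝 (0 : Cn n), (∀ i, (s i).1 z = 0) → z = 0 := by
  have := Fintype.ofFinite ι
  have hev (i : Fin n) : ∀ᶠ z in 𝓝 (0 : Cn n), (∀ i, (s i).1 z = 0) → z i = 0 := by
    have hrad : toGerm n (coord i) ∈ (Ideal.span (Set.range fun i => toGerm n (s i))).radical := by
      rw [Ideal.radical_eq_sInf, Submodule.mem_sInf]
      rintro p ⟨hle, hp⟩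
      exact hs p hp (fun i => hle (Ideal.subset_span ⟨i, rfl⟩)) i
    obtain ⟨N, hN⟩ := hrad
    obtain ⟨c, hc⟩ := Ideal.mem_span_range_iff_exists_fun.1 hN
    choose b hb using fun i => toGerm_surjective (c i)
    have : toGerm n (∑ i, b i * s i) = toGerm n (coord i ^ N) := by
      rw [map_pow, ← hc, map_sum]
      simp only [map_mul, hb]
    filter_upwards [toGerm_eq_iff.1 this] with z hz h0
    rw [← evalAt_apply, ← evalAt_apply, map_sum, map_pow] at hz
    simp only [map_mul, evalAt_apply, h0, mul_zero, Finset.sum_const_zero, coord_apply] at hz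
    exact eq_zero_of_pow_eq_zero hz.symm
  filter_upwards [eventually_all.2 hev] with z hz h0
  exact funext fun i => hz i h0

end An

theorem surjective_iff_exists_minor_ne_zero {n : ℕ} (T : Cn n →L[ℂ] Cn 2) :
    Function.Surjective T ↔ ∃ k l, T (Pi.single k 1) 0 * T (Pi.single l 1) 1 -
      T (Pi.single l 1) 0 * T (Pi.single k 1) 1 ≠ 0 := by
  constructor
  · intro hT
    by_contra! hall
    have hexp (v : Cn n) (j : Fin 2) : T v j = ∑ i, v i * T (Pi.single i 1) j := by
      conv_lhs => rw [pi_eq_sum_univ' v, map_sum]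
      simp
    obtain ⟨v, hv⟩ := hT ![1, 0]
    obtain ⟨w, hw⟩ := hT ![0, 1]
    have hdet : T v 0 * T w 1 - T v 1 * T w 0 = 0 := by
      rw [hexp v 0, hexp v 1, hexp w 0, hexp w 1, Finset.sum_mul_sum, Finset.sum_mul_sum,
        ← Finset.sum_sub_distrib]
      refine Finset.sum_eq_zero fun k _ => ?_
      rw [← Finset.sum_sub_distrib]
      exact Finset.sum_eq_zero fun l _ => by linear_combination v k * w l * hall k l
    simp [hv, hw] at hdet
  · rintro ⟨k, l, h⟩ w
    set Δ := T (Pi.single k 1) 0 * T (Pi.single l 1) 1 - T (Pi.single l 1) 0 * T (Pi.single k 1) 1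
      with hΔ
    refine ⟨((w 0 * T (Pi.single l 1) 1 - w 1 * T (Pi.single l 1) 0) / Δ) • Pi.single k 1 +
      ((w 1 * T (Pi.single k 1) 0 - w 0 * T (Pi.single k 1) 1) / Δ) • Pi.single l 1, ?_⟩
    rw [map_add, map_smul, map_smul]
    ext j
    fin_cases j
    · simp only [Fin.zero_eta, Pi.add_apply, Pi.smul_apply, smul_eq_mul]
      field_simp
      rw [hΔ]
      ring
    · simp only [Fin.mk_one, Pi.add_apply, Pi.smul_apply, smul_eq_mul]
      field_simp
      rw [hΔ]
      ring

namespace An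

variable {n : ℕ}

/-- The map with given analytic components. -/
def toMap (g : Fin 2 → An n) : Cn n → Cn 2 := fun z j => (g j).1 z

theorem analyticAt_toMap (g : Fin 2 → An n) : AnalyticAt ℂ (toMap g) 0 :=
  AnalyticAt.pi fun j => (g j).2

/-- The `2 × 2` minors of the differential of a map to the plane. -/
def minor (g : Fin 2 → An n) (q : Fin n × Fin n) : An n :=
  partialDeriv q.1 (g 0) * partialDeriv q.2 (g 1) - partialDeriv q.2 (g 0) * partialDeriv q.1 (g 1)

theorem eventually_surjective_iff (g : Fin 2 → An n) : ∀ᶠ z in 𝓝 (0 : Cn n),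
    (¬ Function.Surjective (fderiv ℂ (toMap g) z) ↔ ∀ q, (minor g q).1 z = 0) := by
  filter_upwards [eventually_all.2 fun j => eventually_differentiableAt (g j)] with z hz
  have hfd (i : Fin n) (j : Fin 2) :
      fderiv ℂ (toMap g) z (Pi.single i 1) j = (partialDeriv i (g j)).1 z := by
    change fderiv ℂ (fun z j => (g j).1 z) z _ j = fderiv ℂ (g j).1 z _
    rw [fderiv_pi hz]
    rfl
  rw [surjective_iff_exists_minor_ne_zero]
  simp only [hfd]
  push Not
  exact ⟨fun h q => h q.1 q.2, fun h k l => h (k, l)⟩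

section

variable {g : Fin 2 → An n} (hg : toMap g 0 = 0) (h : An 2)

theorem partialDeriv_pull (i : Fin n) :
    (partialDeriv i (pull (toMap g) (analyticAt_toMap g) hg h)).1 =ᶠ[𝓝 0]
      (∑ j, pull (toMap g) (analyticAt_toMap g) hg (partialDeriv j h) *
        partialDeriv i (g j)).1 := by
  have hG : Tendsto (toMap g) (𝓝 0) (𝓝 0) := by
    simpa [hg] using (analyticAt_toMap g).continuousAt.tendsto
  filter_upwards [hG.eventually (eventually_differentiableAt h),
    eventually_all.2 fun j => eventually_differentiableAt (g j)] with z hz hgz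
  have hd : DifferentiableAt ℂ (toMap g) z := differentiableAt_pi.2 hgz
  conv_rhs => rw [← evalAt_apply, map_sum]
  change fderiv ℂ (h.1 ∘ toMap g) z (Pi.single i 1) = _
  rw [fderiv_comp z hz hd, ContinuousLinearMap.comp_apply, fderiv_eq_sum_pder]
  refine Finset.sum_congr rfl fun j _ => ?_
  rw [mul_comm]
  change _ = pder h.1 j (toMap g z) * fderiv ℂ (g j).1 z (Pi.single i 1)
  congr 1
  change fderiv ℂ (fun z j => (g j).1 z) z _ j = _
  rw [fderiv_pi hgz]
  rfl

end

variable {F : Type} [Field F] [Algebra ℂ F] {φ : An n →ₐ[ℂ] F}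

theorem IsGermHom.eq_zero_of_isTangent (hφ : IsGermHom φ) (hgen : Generates (φ : An n →+* F))
    {f : An n} (hf : f.1 0 = 0) (hD : ∀ D, IsTangent φ D → D (φ f) = 0) : φ f = 0 := by
  obtain ⟨c, hc⟩ := mem_range_algebraMap n hφ hgen hD
  by_cases hc0 : c = 0
  · rw [← hc, hc0, map_zero]
  · have hu := hφ.isUnit (f := f - algebraMap ℂ (An n) c) (by
      change f.1 0 - c ≠ 0
      simpa [hf] using hc0)
    rw [map_sub, φ.commutes, hc, sub_self] at hu
    exact absurd hu not_isUnit_zero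

theorem IsGermHom.eq_zero_of_partialDeriv (hφ : IsGermHom φ)
    (hgen : Generates (φ : An n →+* F)) {f : An n} (hf : f.1 0 = 0)
    (hJ : ∀ i, φ (partialDeriv i f) = 0) : φ f = 0 :=
  hφ.eq_zero_of_isTangent hgen hf fun D hD => by simp [hD f, hJ]

theorem IsGermHom.partialDeriv_eq_zero_or (hφ : IsGermHom φ) (hgen : Generates (φ : An n →+* F))
    {g : Fin 2 → An n} (hg : toMap g 0 = 0) (h : An 2) (hminor : ∀ q, φ (minor g q) = 0)
    (hf : φ (pull (toMap g) (analyticAt_toMap g) hg h) = 0) :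
    (∀ i, φ (partialDeriv i (pull (toMap g) (analyticAt_toMap g) hg h)) = 0) ∨
      ∀ j, φ (g j) = 0 := by
  by_cases H : ∀ D, IsTangent φ D → ∀ j, D (φ (g j)) = 0
  · exact Or.inr fun j => hφ.eq_zero_of_isTangent hgen (congrFun hg j) fun D hD => H D hD j
  push Not at H
  obtain ⟨D, hD, j₀, hj₀⟩ := H
  left
  set k : Fin 2 → F := fun j => φ (pull (toMap g) (analyticAt_toMap g) hg (partialDeriv j h)) with hk
  have hchain (i : Fin n) : φ (partialDeriv i (pull (toMap g) (analyticAt_toMap g) hg h)) =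
      k 0 * φ (partialDeriv i (g 0)) + k 1 * φ (partialDeriv i (g 1)) := by
    rw [hφ _ _ (partialDeriv_pull hg h i), map_sum, Fin.sum_univ_two, map_mul, map_mul]
  have hsum : k 0 * D (φ (g 0)) + k 1 * D (φ (g 1)) = 0 := by
    have h0 := hD (pull (toMap g) (analyticAt_toMap g) hg h)
    rw [hf, map_zero] at h0
    rw [h0, hD, hD, Finset.mul_sum, Finset.mul_sum, ← Finset.sum_add_distrib]
    refine Finset.sum_congr rfl fun i _ => ?_
    rw [hchain]
    ring
  have hprop (l : Fin n) : D (φ (g 0)) * φ (partialDeriv l (g 1)) =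
      D (φ (g 1)) * φ (partialDeriv l (g 0)) := by
    rw [hD, hD, Finset.sum_mul, Finset.sum_mul]
    refine Finset.sum_congr rfl fun i _ => ?_
    have := hminor (i, l)
    simp only [minor, map_sub, map_mul] at this
    linear_combination D (φ (coord i)) * this
  intro l
  rw [hchain]
  refine (mul_eq_zero.1 (?_ : D (φ (g j₀)) * _ = 0)).resolve_left hj₀
  fin_cases j₀
  · simp only [Fin.zero_eta]
    linear_combination φ (partialDeriv l (g 0)) * hsum + k 1 * hprop l
  · simp only [Fin.mk_one]
    linear_combination φ (partialDeriv l (g 1)) * hsum - k 0 * hprop l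

end An

theorem exists_pow_mul_mem_of_finite_map {k R : Type*} [Field k] [CommRing R] [Algebra k R]
    {I J : Ideal R}
    (hI : Module.Finite k ((I.map (Ideal.Quotient.mk J)).restrictScalars k : Submodule k (R ⧸ J)))
    {z x : R} (hx : x ∈ I)
    (hz : ∀ P : Polynomial k, P.coeff 0 ≠ 0 →
      IsUnit (Polynomial.aeval (Ideal.Quotient.mk J z) P)) :
    ∃ a : ℕ, z ^ a * x ∈ J := by
  obtain ⟨a, ha⟩ := exists_pow_mul_eq_zero hI (Ideal.mem_map_of_mem _ hx) hz
  exact ⟨a, by rwa [← map_pow, ← map_mul, Ideal.Quotient.eq_zero_iff_mem] at ha⟩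

namespace An

variable {n : ℕ}

section

variable {g : Fin 2 → An n} (hg : toMap g 0 = 0) (h : An 2)

/-- Functions whose common zeros are the critical points of `g` on the zero set of `h ∘ g`. -/
def criticalSystem : Option (Fin n × Fin n) → An n :=
  fun o => o.elim (pull (toMap g) (analyticAt_toMap g) hg h) (minor g)

/-- The ideal generated by the partial derivatives of `h ∘ g`. -/
def pulledJacobian : Ideal (On n) := Ideal.span (Set.range fun i =>
  toGerm n (partialDeriv i (pull (toMap g) (analyticAt_toMap g) hg h)))

/-- The ideal generated by the pullbacks along `g` of the partial derivatives of `h`. -/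
def pulledPartials : Ideal (On n) := Ideal.span (Set.range fun j =>
  toGerm n (pull (toMap g) (analyticAt_toMap g) hg (partialDeriv j h)))

theorem toGerm_partialDeriv_pull (i : Fin n) :
    toGerm n (partialDeriv i (pull (toMap g) (analyticAt_toMap g) hg h)) =
      toGerm n (pull (toMap g) (analyticAt_toMap g) hg (partialDeriv 0 h)) *
          toGerm n (partialDeriv i (g 0)) +
        toGerm n (pull (toMap g) (analyticAt_toMap g) hg (partialDeriv 1 h)) *
          toGerm n (partialDeriv i (g 1)) := by
  rw [isGermHom_toGerm _ _ (partialDeriv_pull hg h i), map_sum, Fin.sum_univ_two, map_mul, map_mul]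

theorem minor_mul_mem_pulledJacobian (q : Fin n × Fin n) (j : Fin 2) :
    toGerm n (minor g q) * toGerm n (pull (toMap g) (analyticAt_toMap g) hg (partialDeriv j h)) ∈
      pulledJacobian hg h := by
  have hmem (i : Fin n) : toGerm n (partialDeriv i (pull (toMap g) (analyticAt_toMap g) hg h)) ∈
      pulledJacobian hg h := Ideal.subset_span ⟨i, rfl⟩
  have h1 := hmem q.1
  have h2 := hmem q.2
  rw [toGerm_partialDeriv_pull] at h1 h2
  rw [minor, map_sub, map_mul, map_mul]
  fin_cases j
  · convert sub_mem (Ideal.mul_mem_left _ (toGerm n (partialDeriv q.2 (g 1))) h1)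
      (Ideal.mul_mem_left _ (toGerm n (partialDeriv q.1 (g 1))) h2) using 1
    simp only [Fin.zero_eta]
    ring
  · convert sub_mem (Ideal.mul_mem_left _ (toGerm n (partialDeriv q.1 (g 0))) h2)
      (Ideal.mul_mem_left _ (toGerm n (partialDeriv q.2 (g 0))) h1) using 1
    simp only [Fin.mk_one]
    ring

theorem exists_pow_coord_mul_mem (hh : h.1 0 = 0)
    (hcrit : ∀ᶠ z in 𝓝 (0 : Cn n), (∀ o, (criticalSystem hg h o).1 z = 0) → z = 0) :
    ∃ N, ∀ i j, toGerm n (coord i) ^ N *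
      toGerm n (pull (toMap g) (analyticAt_toMap g) hg (partialDeriv j h)) ∈
        pulledJacobian hg h := by
  set k : Fin 2 → On n := fun j =>
    toGerm n (pull (toMap g) (analyticAt_toMap g) hg (partialDeriv j h)) with hk
  let A : Ideal (On n) := (pulledJacobian hg h).colon (Set.range k)
  have hrad (i : Fin n) : toGerm n (coord i) ∈ A.radical := by
    rw [Ideal.radical_eq_sInf, Submodule.mem_sInf]
    rintro p ⟨hle, hp⟩
    refine coord_mem_of_isPrime hcrit hp (fun o => ?_) i
    cases o with
    | some q =>
      refine hle (Submodule.mem_colon.2 ?_)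
      rintro _ ⟨j, rfl⟩
      exact minor_mul_mem_pulledJacobian hg h q j
    | none =>
      obtain ⟨F, _, _, φ, hφ, hgen, hφ0⟩ := exists_field hp
      refine (hφ0 _).1 (hφ.eq_zero_of_partialDeriv hgen ?_ fun i => (hφ0 _).2 (hle ?_))
      · change h.1 (toMap g 0) = 0
        rw [hg, hh]
      · exact Submodule.mem_colon.2 fun s _ =>
          Ideal.mul_mem_right _ _ (Ideal.subset_span ⟨i, rfl⟩)
  choose N hN using hrad
  refine ⟨∑ i, N i, fun i j => ?_⟩
  have hle : N i ≤ ∑ i, N i := Finset.single_le_sum (fun _ _ => Nat.zero_le _) (Finset.mem_univ i)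
  have hA : toGerm n (coord i) ^ (∑ i, N i) ∈ A := Ideal.pow_mem_of_pow_mem A (hN i) hle
  exact Submodule.mem_colon.1 hA _ ⟨j, rfl⟩

theorem finite_quotIJ_of_forall_pow_mul_mem {m N : ℕ} {k : Fin m → On n} {J : Ideal (On n)}
    (hk : ∀ i j, toGerm n (coord i) ^ N * k j ∈ J) :
    Module.Finite ℂ (quotIJ (Ideal.span (Set.range k)) J) := by
  have := finite_restrictScalars_span (k := ℂ) (N := N)
    (fun i => Ideal.Quotient.mk J (toGerm n (coord i))) (fun f => ?_)
    (fun j => Ideal.Quotient.mk J (k j)) fun i j => by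
      rw [← map_pow, ← map_mul, Ideal.Quotient.eq_zero_iff_mem]
      exact hk i j
  · rw [quotIJ, Ideal.map_span, ← Set.range_comp]
    exact this
  · obtain ⟨f, rfl⟩ := Ideal.Quotient.mk_surjective f
    obtain ⟨f, rfl⟩ := toGerm_surjective f
    obtain ⟨b, hb⟩ := exists_eq_add_sum f
    refine ⟨f.1 0, fun i => Ideal.Quotient.mk J (toGerm n (b i)), ?_⟩
    rw [isGermHom_toGerm _ _ hb]
    simp only [map_add, map_sum, map_mul, AlgHom.commutes]
    rfl

theorem isUnit_aeval_mk_toGerm_coord (J : Ideal (On n)) (i : Fin n) {P : Polynomial ℂ}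
    (hP : P.coeff 0 ≠ 0) :
    IsUnit (Polynomial.aeval (Ideal.Quotient.mk J (toGerm n (coord i))) P) := by
  have hu : IsUnit (toGerm n (Polynomial.aeval (coord i) P)) := isGermHom_toGerm.isUnit (by
    rwa [← evalAt_apply, ← Polynomial.aeval_algHom_apply, evalAt_apply, coord_apply, Pi.zero_apply,
      ← Polynomial.coeff_zero_eq_aeval_zero])
  have hcomp : Polynomial.aeval (Ideal.Quotient.mk J (toGerm n (coord i))) P =
      ((Ideal.Quotient.mkₐ ℂ J).comp (toGerm n)) (Polynomial.aeval (coord i) P) :=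
    Polynomial.aeval_algHom_apply ((Ideal.Quotient.mkₐ ℂ J).comp (toGerm n)) (coord i) P
  rw [hcomp]
  exact hu.map (Ideal.Quotient.mk J)

theorem exists_pow_coord_mul_mem_of_finite {J I : Ideal (On n)}
    (hfin : Module.Finite ℂ (quotIJ I J)) {x : On n} (hx : x ∈ I) (i : Fin n) :
    ∃ a : ℕ, toGerm n (coord i) ^ a * x ∈ J :=
  exists_pow_mul_mem_of_finite_map hfin hx fun _ hP => isUnit_aeval_mk_toGerm_coord J i hP

theorem eventually_criticalSystem_of_finite
    (hiso : ∀ᶠ w in 𝓝 (0 : Cn 2), (∀ j, (partialDeriv j h).1 w = 0) → w = 0)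
    (hICIS : ∀ᶠ z in 𝓝 (0 : Cn n), (∀ o, (Sum.elim g (minor g) o).1 z = 0) → z = 0)
    (hfin : Module.Finite ℂ (quotIJ (pulledPartials hg h) (pulledJacobian hg h))) :
    ∀ᶠ z in 𝓝 (0 : Cn n), (∀ o, (criticalSystem hg h o).1 z = 0) → z = 0 := by
  refine eventually_eq_zero_of_isPrime fun p hp hsp => ?_
  by_contra! hcoord
  obtain ⟨i, hi⟩ := hcoord
  obtain ⟨F, _, _, φ, hφ, hgen, hφ0⟩ := exists_field hp
  have hminor (q) : φ (minor g q) = 0 := (hφ0 _).2 (hsp (some q))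
  have hgz : ∀ j, φ (g j) = 0 := by
    rcases hφ.partialDeriv_eq_zero_or hgen hg h hminor ((hφ0 _).2 (hsp none)) with hJ | hgz
    · have hJp : pulledJacobian hg h ≤ p := Ideal.span_le.2 <| by
        rintro _ ⟨l, rfl⟩
        exact (hφ0 _).1 (hJ l)
      have hk (j : Fin 2) : φ (pull (toMap g) (analyticAt_toMap g) hg (partialDeriv j h)) = 0 := by
        obtain ⟨a, ha⟩ := exists_pow_coord_mul_mem_of_finite hfin
          (Ideal.subset_span ⟨j, rfl⟩ : toGerm n (pull (toMap g) (analyticAt_toMap g) hg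
            (partialDeriv j h)) ∈ pulledPartials hg h) i
        exact (hφ0 _).2 ((hp.mem_or_mem (hJp ha)).resolve_left fun hmem =>
          hi (hp.mem_of_pow_mem _ hmem))
      by_contra! hne
      have hfreq := frequently_zero (hφ.comp_pull (toMap g) (analyticAt_toMap g) hg) hne
        (fun j => partialDeriv j h) hk
      obtain ⟨w, hw, hw1, hw0⟩ := (hfreq.and_eventually
        ((hiso.filter_mono nhdsWithin_le_nhds).and self_mem_nhdsWithin)).exists
      exact hw0 (hw1 hw)
    · exact hgz
  refine hi (coord_mem_of_isPrime hICIS hp (fun o => (hφ0 _).1 ?_) i)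
  rcases o with j | q
  exacts [hgz j, hminor q]

/-- Finiteness of the quotient of the ideal of pulled back partial derivatives of `h` by the
jacobian ideal of `h ∘ g`, in terms of the critical points of `g` where `h ∘ g` vanishes. -/
theorem finite_quotIJ_iff (hh : h.1 0 = 0)
    (hiso : ∀ᶠ w in 𝓝 (0 : Cn 2), (∀ j, (partialDeriv j h).1 w = 0) → w = 0)
    (hICIS : ∀ᶠ z in 𝓝 (0 : Cn n), (∀ o, (Sum.elim g (minor g) o).1 z = 0) → z = 0) :
    Module.Finite ℂ (quotIJ (pulledPartials hg h) (pulledJacobian hg h)) ↔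
      ∀ᶠ z in 𝓝 (0 : Cn n), (∀ o, (criticalSystem hg h o).1 z = 0) → z = 0 := by
  refine ⟨eventually_criticalSystem_of_finite hg h hiso hICIS, fun hcrit => ?_⟩
  obtain ⟨N, hN⟩ := exists_pow_coord_mul_mem hg h hh hcrit
  exact finite_quotIJ_of_forall_pow_mul_mem hN

end

end An

/-- **Corollary 3.8.** Let `G = (g₁, g₂)` define an ICIS of dimension
`d = n - 2 > 1`, let `h` have an isolated singularity at `0 ∈ ℂ²`, `f = h ∘ G`,
and let `K = G*(J(h))O_n` be the ideal generated by the germs of the pullbacks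
of the partials of `h`.  Then `dim_ℂ K/J(f) < ∞` iff `f⁻¹(0) ∩ S(G) ⊆ {0}`
near `0`, where `S(G)` is the critical set of `G`. -/
theorem corollary_3_8 (n : ℕ) (hn : 4 ≤ n)
    (Ω : Set (Cn n)) (hΩ : IsOpen Ω) (h0Ω : (0 : Cn n) ∈ Ω)
    (g : Fin 2 → Cn n → ℂ) (hg : ∀ i, AnalyticOnNhd ℂ (g i) Ω)
    (hg0 : ∀ i, g i 0 = 0)
    (G : Cn n → (Fin 2 → ℂ)) (hG : G = fun z i => g i z)
    (hdim : ringKrullDim ((On n) ⧸ idealOfFuns (Set.range g)) = ((n - 2 : ℕ) : ℕ))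
    (hICIS : ∀ᶠ z in 𝓝 (0 : Cn n), G z = 0 → z ≠ 0 →
      Function.Surjective (fderiv ℂ G z))
    (Uh : Set (Fin 2 → ℂ)) (hUh : IsOpen Uh) (h0Uh : (0 : Fin 2 → ℂ) ∈ Uh)
    (h : (Fin 2 → ℂ) → ℂ) (hh : AnalyticOnNhd ℂ h Uh) (hh0 : h 0 = 0)
    (hiso : ∀ᶠ w in 𝓝 (0 : Fin 2 → ℂ), w ≠ 0 → fderiv ℂ h w ≠ 0)
    (f : Cn n → ℂ) (hf : f = h ∘ G)
    (K : Ideal (On n))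
    (hK : K = idealOfFuns (Set.range fun i : Fin 2 =>
      fun z => fderiv ℂ h (G z) (Pi.single i 1))) :
    Module.Finite ℂ (quotIJ K (jacobianIdeal f)) ↔
      ∃ W ∈ 𝓝 (0 : Cn n), ∀ z ∈ W, z ∈ Ω → f z = 0 →
        ¬ Function.Surjective (fderiv ℂ G z) → z = 0 := by
  subst hG hf hK
  let g' : Fin 2 → An n := fun j => ⟨g j, hg j 0 h0Ω⟩
  let h' : An 2 := ⟨h, hh 0 h0Uh⟩
  have hg' : An.toMap g' 0 = 0 := funext hg0
  have hiso' : ∀ᶠ w in 𝓝 (0 : Cn 2), (∀ j, (An.partialDeriv j h').1 w = 0) → w = 0 := by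
    filter_upwards [hiso] with w hw hj
    by_contra hne
    refine hw hne (ContinuousLinearMap.ext fun v => ?_)
    rw [An.fderiv_eq_sum_pder]
    exact Finset.sum_eq_zero fun j _ => mul_eq_zero_of_right _ (hj j)
  have hICIS' : ∀ᶠ z in 𝓝 (0 : Cn n),
      (∀ o, (Sum.elim g' (An.minor g') o).1 z = 0) → z = 0 := by
    filter_upwards [hICIS, An.eventually_surjective_iff g'] with z hz hsurj ho
    by_contra hne
    exact hsurj.2 (fun q => ho (.inr q)) (hz (funext fun j => ho (.inl j)) hne)
  have hJ : jacobianIdeal (h ∘ fun z i => g i z) = An.pulledJacobian hg' h' :=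
    An.idealOfFuns_range fun i => An.partialDeriv i (An.pull _ (An.analyticAt_toMap g') hg' h')
  have hK : idealOfFuns (Set.range fun i : Fin 2 =>
      fun z => fderiv ℂ h (fun j => g j z) (Pi.single i 1)) = An.pulledPartials hg' h' :=
    An.idealOfFuns_range fun i => An.pull _ (An.analyticAt_toMap g') hg' (An.partialDeriv i h')
  rw [hJ, hK, An.finite_quotIJ_iff hg' h' hh0 hiso' hICIS', ← Filter.eventually_iff_exists_mem]
  refine eventually_congr ?_
  filter_upwards [hΩ.mem_nhds h0Ω, An.eventually_surjective_iff g'] with z hz hsurj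
  refine ⟨fun H _ hfz hS => H fun o => ?_, fun H ho => H hz (ho none) ?_⟩
  · cases o with
    | none => exact hfz
    | some q => exact hsurj.1 hS q
  · exact hsurj.2 fun q => ho (some q)

end
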